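/- Let G be a finitely generated nilpotent group with finite symmetric generating set and associated word metric d. For every integer m ≥ 1 there is a constant c such that for every n > 0 and every t ≤ n, the expectation E(d(e, w(t))^m) taken over uniformly random closed lazy words w of length n satisfies E(d(e, w(t))^m) ≤ c · t^{m/2}. -/

import Mathlib

/-!
Statement 8: Let `G` be a finitely generated nilpotent group with finite symmetric
generating set and word metric `d`.  For every integer `m ≥ 1` there is a constant `c`
such that for every `n > 0` and every `t ≤ n`, the expectation over uniformly random
closed lazy words `w` of length `n` satisfies `E(d(e, w(t))^m) ≤ c · t^(m/2)`.
-/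

namespace AvgDehnPaper

variable {G : Type*} [Group G]

/-- The word length of `g` with respect to the (symmetric) generating set `S`:
the least length of a word in the letters of `S` spelling `g`.  For a symmetric
generating set, `d(x, y) = wordLength S (x⁻¹ * y)` is the word metric. -/
noncomputable def wordLength (S : Finset G) (g : G) : ℕ :=
  sInf { k | ∃ l : List G, l.length = k ∧ (∀ x ∈ l, x ∈ S) ∧ l.prod = g }

/-- The value in `G` of a lazy letter over `S`: `none` is the identity. -/
def lazyVal {S : Finset G} (a : Option {x // x ∈ S}) : G :=
  a.elim 1 Subtype.val

/-- The position `w(t)` of the path spelled by a lazy word `w` after `t` steps. -/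
def walkPos {S : Finset G} {n : ℕ} (w : Fin n → Option {x // x ∈ S}) (t : ℕ) : G :=
  (((List.ofFn w).take t).map lazyVal).prod

open scoped Classical in
/-- The (finite, nonempty) set of closed lazy words of length `n` over `S`. -/
noncomputable def closedWalks (S : Finset G) (n : ℕ) :
    Finset (Fin n → Option {x // x ∈ S}) :=
  Finset.univ.filter (fun w => walkPos w n = 1)

section Commutators

open scoped commutatorElement

/-- The iterated commutators of elements of `S`, indexed by their weight. -/
inductive IsComm (S : Set G) : ℕ → G → Prop
  | base {s : G} : s ∈ S → IsComm S 1 s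
  | comm {i j : ℕ} {x y : G} : IsComm S i x → IsComm S j y → IsComm S (i + j) ⁅x, y⁆

variable {S : Set G}

lemma IsComm.pos {i : ℕ} {x : G} (h : IsComm S i x) : 1 ≤ i := by
  induction h with
  | base _ => exact le_rfl
  | comm _ _ h1 h2 => omega

lemma IsComm.inv (hS : ∀ x ∈ S, x⁻¹ ∈ S) {i : ℕ} {x : G} (h : IsComm S i x) :
    IsComm S i x⁻¹ := by
  cases h with
  | base h => exact .base (hS _ h)
  | comm h1 h2 =>
    rw [commutatorElement_inv, add_comm]
    exact .comm h2 h1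

lemma finite_isComm (hS : S.Finite) (w : ℕ) : {x | IsComm S w x}.Finite := by
  induction w using Nat.strong_induction_on with
  | _ w ih =>
    have hfin : (S ∪ ⋃ i ∈ Finset.Ico 1 w,
        Set.image2 (fun x y => ⁅x, y⁆) {x | IsComm S i x} {x | IsComm S (w - i) x}).Finite := by
      refine hS.union (Set.Finite.biUnion (Finset.finite_toSet (Finset.Ico 1 w)) fun i hi => ?_)
      simp only [Finset.coe_Ico, Set.mem_Ico] at hi
      exact (ih i hi.2).image2 _ (ih (w - i) (by omega))
    refine hfin.subset ?_
    rintro x hx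
    cases hx with
    | base h => exact Or.inl h
    | @comm i j x y h1 h2 =>
      have := h1.pos
      have := h2.pos
      refine Or.inr (Set.mem_biUnion (x := i) (by simp; omega) ⟨x, h1, y, ?_, rfl⟩)
      simpa using h2

lemma commutator_commutator_le {H₁ H₂ H₃ N : Subgroup G} [N.Normal]
    (h1 : ⁅⁅H₂, H₃⁆, H₁⁆ ≤ N) (h2 : ⁅⁅H₃, H₁⁆, H₂⁆ ≤ N) : ⁅⁅H₁, H₂⁆, H₃⁆ ≤ N := by
  rw [← QuotientGroup.ker_mk' N, ← (Subgroup.map_eq_bot_iff _)] at h1 h2 ⊢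
  simp only [Subgroup.map_commutator] at h1 h2 ⊢
  exact Subgroup.commutator_commutator_eq_bot_of_rotate h1 h2

lemma commutator_lowerCentralSeries_le (i j : ℕ) :
    ⁅(⊤ : Subgroup G).lowerCentralSeries i, (⊤ : Subgroup G).lowerCentralSeries j⁆ ≤
      (⊤ : Subgroup G).lowerCentralSeries (i + j + 1) := by
  induction j generalizing i with
  | zero => exact le_rfl
  | succ j ih =>
    rw [Subgroup.commutator_comm, Subgroup.lowerCentralSeries_succ]
    refine commutator_commutator_le ?_ ?_
    · rw [Subgroup.commutator_comm ⊤, ← Subgroup.lowerCentralSeries_succ]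
      refine (ih (i + 1)).trans (le_of_eq ?_)
      congr 1
      omega
    · refine (Subgroup.commutator_mono (ih i) le_rfl).trans ?_
      rw [← Subgroup.lowerCentralSeries_succ]
      exact le_of_eq (by congr 1)

lemma IsComm.mem_lowerCentralSeries {i : ℕ} {x : G} (h : IsComm S i x) :
    x ∈ (⊤ : Subgroup G).lowerCentralSeries (i - 1) := by
  induction h with
  | base _ => simp
  | @comm i j x y h1 h2 ih1 ih2 =>
    have := commutator_lowerCentralSeries_le _ _ (Subgroup.commutator_mem_commutator ih1 ih2)
    have h1 := h1.pos
    have h2 := h2.pos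
    rwa [show i - 1 + (j - 1) + 1 = i + j - 1 by omega] at this

lemma exists_isComm_eq_one (hG : Group.IsNilpotent G) :
    ∃ c : ℕ, ∀ w x, c < w → IsComm S w x → x = 1 := by
  obtain ⟨n, hn⟩ := Subgroup.nilpotent_iff_lowerCentralSeries.1 hG
  refine ⟨n, fun w x hw hx => ?_⟩
  have := Subgroup.lowerCentralSeries_antitone (S := (⊤ : Subgroup G)) (show n ≤ w - 1 by omega)
    hx.mem_lowerCentralSeries
  rwa [hn, Subgroup.mem_bot] at this

/-- The set of commutators of weight at least `w`, paired with their weights. -/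
def commFrom (S : Set G) (w : ℕ) : Set (ℕ × G) := {p | w ≤ p.1 ∧ IsComm S p.1 p.2}

lemma commFrom_anti {v w : ℕ} (h : v ≤ w) : commFrom S w ⊆ commFrom S v :=
  fun _ hp => ⟨h.trans hp.1, hp.2⟩

/-- `Cost L q C g` means that `g` is a product of letters of `L` of total cost at most `C`, where
a letter of weight `i` costs `q ^ i`. -/
inductive Cost (L : Set (ℕ × G)) (q : ℝ) : ℝ → G → Prop
  | one {C : ℝ} : 0 ≤ C → Cost L q C 1
  | mul {i : ℕ} {x g : G} {C D : ℝ} : (i, x) ∈ L → Cost L q C g → q ^ i + C ≤ D → Cost L q D (x * g)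

variable {L M : Set (ℕ × G)} {q C D : ℝ} {g h u v : G}

lemma Cost.nonneg (hq : 0 ≤ q) (h : Cost L q C g) : 0 ≤ C := by
  induction h with
  | one h => exact h
  | mul _ _ h ih => exact le_trans (by positivity) h

lemma Cost.mono (h : Cost L q C g) (hCD : C ≤ D) : Cost L q D g := by
  cases h with
  | one h => exact .one (h.trans hCD)
  | mul h1 h2 h3 => exact .mul h1 h2 (h3.trans hCD)

lemma Cost.subset (h : Cost L q C g) (hLM : L ⊆ M) : Cost M q C g := by
  induction h with
  | one h => exact .one h
  | mul h1 h2 h3 ih => exact .mul (hLM h1) ih h3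

lemma Cost.mul' (hg : Cost L q C g) (hh : Cost L q D h) : Cost L q (C + D) (g * h) := by
  induction hg with
  | one h => simpa using hh.mono (by linarith)
  | mul h1 h2 h3 ih =>
    rw [mul_assoc]
    exact .mul h1 ih (by linarith)

lemma Cost.letter {i : ℕ} {x : G} (h : (i, x) ∈ L) : Cost L q (q ^ i) x := by
  simpa using Cost.mul h (.one le_rfl) (D := q ^ i) (by simp)

lemma Cost.inv (hL : ∀ i x, (i, x) ∈ L → (i, x⁻¹) ∈ L) (hg : Cost L q C g) :
    Cost L q C g⁻¹ := by
  induction hg with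
  | one h => simpa using Cost.one h
  | mul h1 h2 h3 ih =>
    rw [mul_inv_rev]
    exact (ih.mul' (Cost.letter (hL _ _ h1))).mono (by linarith)

lemma Cost.pow {i : ℕ} {x : G} (hx : (i, x) ∈ L) (n : ℕ) : Cost L q (n * q ^ i) (x ^ n) := by
  induction n with
  | zero => simpa using Cost.one le_rfl
  | succ n ih =>
    rw [pow_succ']
    refine .mul hx ih ?_
    push_cast
    linarith

lemma commFrom_inv (hS : ∀ x ∈ S, x⁻¹ ∈ S) {w : ℕ} (i : ℕ) (x : G) (h : (i, x) ∈ commFrom S w) :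
    (i, x⁻¹) ∈ commFrom S w := ⟨h.1, h.2.inv hS⟩

lemma Cost.eq_one (hL : ∀ p ∈ L, p.2 = 1) (h : Cost L q C g) : g = 1 := by
  induction h with
  | one _ => rfl
  | mul h1 _ _ ih => rw [ih, mul_one]; exact hL _ h1

/-- Conjugation by a word multiplies the cost by at most the exponential of its cost. -/
lemma Cost.conj (hq : 0 ≤ q)
    (hL : ∀ i x j y, (i, x) ∈ L → (j, y) ∈ M → (j + i, ⁅y, x⁆) ∈ L)
    (hg : Cost L q C g) (hv : Cost M q D v) :
    Cost L q (C * Real.exp D) (v * g * v⁻¹) := by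
  have key : ∀ j y C g, (j, y) ∈ M → Cost L q C g →
      Cost L q ((1 + q ^ j) * C) (y * g * y⁻¹) := by
    intro j y C g hy hg
    induction hg with
    | one h => simpa using Cost.one (by positivity)
    | @mul i x g C D h1 h2 h3 ih =>
      have : y * (x * g) * y⁻¹ = ⁅y, x⁆ * (x * (y * g * y⁻¹)) := by
        simp [commutatorElement_def, mul_assoc]
      rw [this]
      refine .mul (hL i x j y h1 hy) (.mul h1 ih le_rfl) ?_
      have : (1 + q ^ j) * (q ^ i + C) ≤ (1 + q ^ j) * D := by gcongr
      rw [pow_add]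
      linarith
  have hC := hg.nonneg hq
  induction hv with
  | @one D h => simpa using hg.mono (le_mul_of_one_le_right hC (by simpa using h))
  | @mul j y v D E h1 h2 h3 ih =>
    have := key j y _ _ h1 ih
    rw [show y * v * g * (y * v)⁻¹ = y * (v * g * v⁻¹) * y⁻¹ by group]
    refine this.mono ?_
    calc (1 + q ^ j) * (C * Real.exp D) ≤ Real.exp (q ^ j) * (C * Real.exp D) := by
          gcongr
          linarith [Real.add_one_le_exp (q ^ j)]
      _ = C * Real.exp (q ^ j + D) := by rw [Real.exp_add]; ring
      _ ≤ _ := by gcongr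

lemma commFrom_comm {w k : ℕ} (i : ℕ) (x : G) (j : ℕ) (y : G)
    (hx : (i, x) ∈ commFrom S w) (hy : (j, y) ∈ commFrom S k) :
    (j + i, ⁅y, x⁆) ∈ commFrom S (k + w) :=
  ⟨add_le_add hy.1 hx.1, .comm hy.2 hx.2⟩

lemma Cost.conj_commFrom (hq : 0 ≤ q) {w k : ℕ} (hg : Cost (commFrom S w) q C g)
    (hv : Cost (commFrom S k) q D v) :
    Cost (commFrom S w) q (C * Real.exp D) (v * g * v⁻¹) :=
  hg.conj hq (fun i x j y hx hy => commFrom_anti (by omega) (commFrom_comm i x j y hx hy)) hv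

lemma Cost.commutator_letter (hq : 0 ≤ q) {i j k : ℕ} {x : G} (hx : (k, x) ∈ commFrom S i)
    (hv : Cost (commFrom S j) q D v) :
    Cost (commFrom S (i + j)) q (q ^ k * (D * Real.exp D)) ⁅x, v⁆ := by
  induction hv with
  | @one D h => simpa using Cost.one (by positivity)
  | @mul l y v D E h1 h2 h3 ih =>
    rw [commutatorElement_mul_right_eq_mul_conj]
    have hD := h2.nonneg hq
    have c1 := ih.conj_commFrom hq (Cost.letter (q := q) h1)
    rw [mul_assoc, mul_assoc, ← mul_assoc y]
    refine Cost.mul (commFrom_comm _ _ _ _ h1 hx) c1 ?_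
    have hl : 0 ≤ q ^ l := by positivity
    have hE : 0 ≤ E := by linarith
    have e1 : 1 ≤ Real.exp (q ^ l + D) := by simp; positivity
    calc q ^ (k + l) + q ^ k * (D * Real.exp D) * Real.exp (q ^ l)
        = q ^ k * (q ^ l * 1 + D * Real.exp (q ^ l + D)) := by rw [Real.exp_add]; ring
      _ ≤ q ^ k * (q ^ l * Real.exp (q ^ l + D) + D * Real.exp (q ^ l + D)) := by gcongr
      _ = q ^ k * ((q ^ l + D) * Real.exp (q ^ l + D)) := by ring
      _ ≤ _ := by gcongr

/-- The commutator of two words of bounded cost has bounded cost, and the weights add up. -/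
lemma Cost.commutator (hq : 0 ≤ q) {i j : ℕ} (hu : Cost (commFrom S i) q C u)
    (hv : Cost (commFrom S j) q D v) :
    Cost (commFrom S (i + j)) q (C * D * Real.exp (C + D)) ⁅u, v⁆ := by
  have hD := hv.nonneg hq
  induction hu with
  | @one C h => simpa using Cost.one (by positivity)
  | @mul k x u C E h1 h2 h3 ih =>
    have hC := h2.nonneg hq
    rw [commutatorElement_mul_left_eq_conj_mul]
    have c1 := ih.conj_commFrom hq (Cost.letter (q := q) h1)
    have c2 := Cost.commutator_letter hq h1 hv
    refine (c1.mul' c2).mono ?_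
    have hk : 0 ≤ q ^ k := by positivity
    have hE : 0 ≤ E := by linarith
    calc C * D * Real.exp (C + D) * Real.exp (q ^ k) + q ^ k * (D * Real.exp D)
        = C * D * Real.exp (q ^ k + C + D) + q ^ k * D * Real.exp (0 + 0 + D) := by
          simp only [Real.exp_add, Real.exp_zero]; ring
      _ ≤ C * D * Real.exp (q ^ k + C + D) + q ^ k * D * Real.exp (q ^ k + C + D) := by gcongr
      _ = (q ^ k + C) * D * Real.exp (q ^ k + C + D) := by ring
      _ ≤ _ := by gcongr

/-- Collecting all occurrences of a letter `t` to the right. -/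
lemma Cost.collect (hS : ∀ x ∈ S, x⁻¹ ∈ S) (hq : 0 ≤ q) {w : ℕ} {t : G} (ht : IsComm S w t)
    (hL1 : commFrom S (w + 1) ⊆ L) (hL2 : L ⊆ commFrom S w)
    (hg : Cost (insert (w, t) (insert (w, t⁻¹) L)) q C g) :
    ∃ (n : ℤ) (h : G), g = h * t ^ n ∧ |n| * q ^ w ≤ C ∧ Cost L q (C * Real.exp C) h := by
  induction hg with
  | @one C h => exact ⟨0, 1, by simp, by simpa using h, .one (by positivity)⟩
  | @mul i x g C D h1 h2 h3 ih =>
    have hC := h2.nonneg hq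
    obtain ⟨n, h, rfl, hn, hh⟩ := ih
    have hD : C ≤ D := le_trans (by linarith [pow_nonneg hq i]) h3
    have hconj : ∀ s, IsComm S w s →
        Cost L q (C * Real.exp C * Real.exp (q ^ w)) (s * h * s⁻¹) := by
      intro s hs
      refine hh.conj (M := {(w, s)}) hq ?_ (Cost.letter rfl)
      rintro i x j y hx ⟨rfl, rfl⟩
      have := (hL2 hx).2.pos
      exact hL1 ⟨by have := (hL2 hx).1; simp at this ⊢; omega, .comm hs (hL2 hx).2⟩
    have hw : 0 ≤ q ^ w := by positivity
    have hbound : ∀ E, q ^ w + C ≤ E →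
        C * Real.exp C * Real.exp (q ^ w) ≤ E * Real.exp E := by
      intro E hE
      rw [mul_assoc, ← Real.exp_add]
      gcongr <;> linarith
    rcases h1 with h1 | h1 | h1
    · obtain ⟨rfl, rfl⟩ := Prod.mk.inj h1
      refine ⟨n + 1, x * h * x⁻¹, ?_, ?_, (hconj x ht).mono (hbound _ h3)⟩
      · simp only [mul_assoc, inv_mul_cancel_left, add_comm n 1, zpow_one_add]
      · push_cast
        calc _ ≤ (|(n : ℝ)| + 1) * q ^ i := by gcongr; exact (abs_add_le _ _).trans (by simp)
          _ ≤ _ := by push_cast at hn; linarith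
    · obtain ⟨rfl, rfl⟩ := Prod.mk.inj h1
      refine ⟨n - 1, t⁻¹ * h * t⁻¹⁻¹, ?_, ?_, (hconj _ (ht.inv hS)).mono (hbound _ h3)⟩
      · simp only [mul_assoc, inv_inv, sub_eq_neg_add, zpow_add, zpow_neg, zpow_one,
          mul_inv_cancel_left]
      · push_cast
        calc _ ≤ (|(n : ℝ)| + 1) * q ^ i := by gcongr; exact (abs_sub _ _).trans (by simp)
          _ ≤ _ := by push_cast at hn; linarith
    · refine ⟨n, x * h, by group, hn.trans hD, .mul h1 hh ?_⟩
      have hi : 0 ≤ q ^ i := by positivity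
      calc q ^ i + C * Real.exp C ≤ q ^ i * Real.exp D + C * Real.exp D := by
            gcongr
            exact le_mul_of_one_le_right hi (by simp; linarith)
        _ = (q ^ i + C) * Real.exp D := by ring
        _ ≤ _ := by gcongr

end Commutators

section WordLength

open scoped commutatorElement

/-- `S` is a symmetric generating set of `G`. -/
structure IsSymmGen (S : Finset G) : Prop where
  closure_eq : Subgroup.closure (S : Set G) = ⊤
  inv_mem : ∀ x ∈ S, x⁻¹ ∈ S

variable {S : Finset G}

lemma wordLength_prod_le (l : List G) (hl : ∀ x ∈ l, x ∈ S) : wordLength S l.prod ≤ l.length :=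
  Nat.sInf_le ⟨l, rfl, hl, rfl⟩

lemma IsSymmGen.exists_word (hS : IsSymmGen S) (g : G) :
    ∃ l : List G, l.length = wordLength S g ∧ (∀ x ∈ l, x ∈ S) ∧ l.prod = g := by
  refine Nat.sInf_mem (s := {k | ∃ l : List G, l.length = k ∧ (∀ x ∈ l, x ∈ S) ∧ l.prod = g}) ?_
  have hg : g ∈ (Subgroup.closure (S : Set G)).toSubmonoid := by
    rw [hS.closure_eq]
    trivial
  rw [Subgroup.closure_toSubmonoid] at hg
  obtain ⟨l, hl, hg⟩ := Submonoid.exists_list_of_mem_closure hg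
  refine ⟨l.length, l, rfl, fun x hx => ?_, hg⟩
  rcases hl x hx with h | h
  · exact h
  · simpa using hS.inv_mem _ h

@[simp] lemma wordLength_one : wordLength S (1 : G) = 0 := by
  simpa using wordLength_prod_le (S := S) [] (by simp)

lemma wordLength_le_one {x : G} (hx : x ∈ S) : wordLength S x ≤ 1 := by
  simpa using wordLength_prod_le (S := S) [x] (by simpa using hx)

lemma IsSymmGen.wordLength_mul_le (hS : IsSymmGen S) (g h : G) :
    wordLength S (g * h) ≤ wordLength S g + wordLength S h := by
  obtain ⟨l, hl, hl', rfl⟩ := hS.exists_word g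
  obtain ⟨k, hk, hk', rfl⟩ := hS.exists_word h
  rw [← hl, ← hk, ← List.prod_append, ← List.length_append]
  refine wordLength_prod_le _ fun x hx => ?_
  rcases List.mem_append.1 hx with h | h
  exacts [hl' x h, hk' x h]

lemma IsSymmGen.wordLength_inv_le (hS : IsSymmGen S) (g : G) :
    wordLength S g⁻¹ ≤ wordLength S g := by
  obtain ⟨l, hl, hl', rfl⟩ := hS.exists_word g
  rw [← hl, List.prod_inv_reverse]
  refine (wordLength_prod_le _ fun x hx => ?_).trans (by simp)
  simp only [List.mem_reverse, List.mem_map] at hx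
  obtain ⟨y, hy, rfl⟩ := hx
  exact hS.inv_mem _ (hl' y hy)

lemma IsSymmGen.wordLength_commutator_le (hS : IsSymmGen S) (g h : G) :
    wordLength S ⁅g, h⁆ ≤ 2 * (wordLength S g + wordLength S h) := by
  have h1 := hS.wordLength_mul_le (g * h * g⁻¹) h⁻¹
  have h2 := hS.wordLength_mul_le (g * h) g⁻¹
  have h3 := hS.wordLength_mul_le g h
  have h4 := hS.wordLength_inv_le g
  have h5 := hS.wordLength_inv_le h
  rw [commutatorElement_def]
  omega

lemma IsSymmGen.cost_of_wordLength (hS : IsSymmGen S) (q : ℝ) (g : G) :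
    Cost (commFrom (S : Set G) 1) q (wordLength S g * q) g := by
  obtain ⟨l, hl, hl', rfl⟩ := hS.exists_word g
  rw [← hl]
  clear hl
  induction l with
  | nil => simpa using Cost.one le_rfl
  | cons x l ih =>
    simp only [List.mem_cons, forall_eq_or_imp] at hl'
    rw [List.prod_cons]
    refine .mul (i := 1) ⟨le_rfl, .base hl'.1⟩ (ih hl'.2) ?_
    push_cast [List.length_cons]
    linarith

/-- Products of conjugates of `t` by elements of `V`. -/
inductive ConjProd (t : G) (V : Set G) : ℕ → G → Prop
  | one : ConjProd t V 0 1
  | mul {n : ℕ} {g v : G} : ConjProd t V n g → v ∈ V → ConjProd t V (n + 1) (g * (v * t * v⁻¹))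

lemma ConjProd.append {t : G} {V : Set G} {m n : ℕ} {g h : G} (hg : ConjProd t V m g)
    (hh : ConjProd t V n h) : ConjProd t V (m + n) (g * h) := by
  induction hh with
  | one => simpa using hg
  | mul _ hv ih =>
    rw [← mul_assoc, ← add_assoc]
    exact ih.mul hv

lemma ConjProd.conj {t x : G} {V W : Set G} {n : ℕ} {g : G} (hg : ConjProd t V n g)
    (hV : ∀ v ∈ V, x * v ∈ W) : ConjProd t W n (x * g * x⁻¹) := by
  induction hg with
  | one => simpa using ConjProd.one
  | @mul n g v _ hv ih =>
    have := ih.mul (hV v hv)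
    convert this using 1
    group

lemma ConjProd.mono {t : G} {V W : Set G} {n : ℕ} {g : G} (hg : ConjProd t V n g)
    (hV : V ⊆ W) : ConjProd t W n g := by
  simpa using hg.conj (x := 1) (W := W) (by simpa using fun v hv => hV hv)

lemma conjProd_commutator_pow_right (x y : G) (b : ℕ) :
    ConjProd ⁅x, y⁆ {v | ∃ l ≤ b, v = y ^ l} b ⁅x, y ^ b⁆ := by
  induction b with
  | zero => simpa using ConjProd.one
  | succ b ih =>
    rw [pow_succ', commutatorElement_mul_right_eq_mul_conj, add_comm b 1, mul_assoc, mul_assoc,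
      ← mul_assoc y]
    refine ConjProd.append ?_ (ih.conj ?_)
    · simpa using ConjProd.one.mul (V := {v | ∃ l ≤ 1 + b, v = y ^ l}) (t := ⁅x, y⁆) (v := 1)
        ⟨0, by simp⟩
    · rintro v ⟨l, hl, rfl⟩
      exact ⟨l + 1, by omega, (pow_succ' y l).symm⟩

lemma conjProd_commutator_pow (x y : G) (a b : ℕ) :
    ConjProd ⁅x, y⁆ {v | ∃ k ≤ a, ∃ l ≤ b, v = x ^ k * y ^ l} (a * b) ⁅x ^ a, y ^ b⁆ := by
  induction a with
  | zero => simpa using ConjProd.one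
  | succ a ih =>
    rw [pow_succ', commutatorElement_mul_left_eq_conj_mul, add_mul, one_mul]
    refine ConjProd.append (ih.conj ?_) ((conjProd_commutator_pow_right x y b).mono ?_)
    · rintro v ⟨k, hk, l, hl, rfl⟩
      exact ⟨k + 1, by omega, l, hl, by rw [pow_succ', mul_assoc]⟩
    · rintro v ⟨l, hl, rfl⟩
      exact ⟨0, by omega, l, hl, by simp⟩

lemma ConjProd.cost {S : Set G} {q : ℝ} (hq : 0 ≤ q) (hq1 : q ≤ 1) {w : ℕ} {t : G}
    (ht : IsComm S w t) {V : Set G} (hV : ∀ v ∈ V, Cost (commFrom S 1) q 2 v) {n : ℕ} {g : G}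
    (hg : ConjProd t V n g) (hn : n * q ^ w ≤ 1) :
    Cost (commFrom S (w + 1)) q (n * q ^ w * (2 * Real.exp 4)) (g * (t ^ n)⁻¹) := by
  induction hg with
  | one => simpa using Cost.one le_rfl
  | @mul n g v hg hv ih =>
    have hw : 0 ≤ q ^ w := by positivity
    have hw1 : q ^ w ≤ 1 := pow_le_one₀ hq hq1
    push_cast at hn
    have htw : (w, t) ∈ commFrom S w := ⟨le_rfl, ht⟩
    have c1 : Cost (commFrom S (w + 1)) q (q ^ w * (2 * Real.exp 3)) ⁅v, t⁆ := by
      rw [add_comm]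
      refine (Cost.commutator hq (hV v hv) (Cost.letter htw)).mono ?_
      rw [mul_comm 2, mul_assoc]
      gcongr
      linarith
    have c2 := c1.conj_commFrom hq ((Cost.pow (q := q) htw n).mono (D := 1) (by linarith))
    have := (ih (by linarith)).mul' c2
    convert this using 1
    · rw [show (4 : ℝ) = 3 + 1 by norm_num, Real.exp_add]
      push_cast
      ring
    · rw [commutatorElement_def, pow_succ]
      group

lemma commutator_pow_approx (hS : IsSymmGen S) {i j : ℕ} {x y : G}
    (hx : IsComm (S : Set G) i x) (hy : IsComm (S : Set G) j y) {Kx Ky : ℕ} {Cx Cy : ℝ}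
    (ihx : ∀ r : ℕ, 1 ≤ r → ∀ n ≤ r ^ i, ∃ g, wordLength S g ≤ Kx * r ∧
      Cost (commFrom (S : Set G) (i + 1)) (r : ℝ)⁻¹ Cx (g⁻¹ * x ^ n))
    (ihy : ∀ r : ℕ, 1 ≤ r → ∀ n ≤ r ^ j, ∃ g, wordLength S g ≤ Ky * r ∧
      Cost (commFrom (S : Set G) (j + 1)) (r : ℝ)⁻¹ Cy (g⁻¹ * y ^ n)) :
    ∃ (K : ℕ) (C : ℝ), ∀ r : ℕ, 1 ≤ r → ∀ a ≤ r ^ i, ∀ b ≤ r ^ j, ∃ g, wordLength S g ≤ K * r ∧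
      Cost (commFrom (S : Set G) (i + j + 1)) (r : ℝ)⁻¹ C (g⁻¹ * ⁅x, y⁆ ^ (a * b)) := by
  refine ⟨2 * (Kx + Ky), (2 * Real.exp 4 + Cx * 1 * Real.exp (Cx + 1) * Real.exp Kx) *
    Real.exp (2 * (Kx + Ky)) + (1 + Cx) * Cy * Real.exp (1 + Cx + Cy) * Real.exp Ky,
    fun r hr a ha b hb => ?_⟩
  obtain ⟨gx, hgx, chx⟩ := ihx r hr a ha
  obtain ⟨gy, hgy, chy⟩ := ihy r hr b hb
  have hr0 : (0 : ℝ) < r := by exact_mod_cast hr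
  set q : ℝ := (r : ℝ)⁻¹ with hqdef
  have hq : 0 ≤ q := by positivity
  have hq1 : q ≤ 1 := inv_le_one_of_one_le₀ (by exact_mod_cast hr)
  have hscale : ∀ (n k : ℕ), n ≤ r ^ k → (n : ℝ) * q ^ k ≤ 1 := by
    intro n k hn
    rw [hqdef, inv_pow, ← div_eq_mul_inv]
    exact div_le_one_of_le₀ (by exact_mod_cast hn) (by positivity)
  have hlen : ∀ (g : G) (K : ℕ), wordLength S g ≤ K * r → Cost (commFrom (S : Set G) 1) q K g := by
    intro g K hg
    refine (hS.cost_of_wordLength q g).mono ?_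
    rw [hqdef, ← div_eq_mul_inv, div_le_iff₀ hr0]
    exact_mod_cast hg
  have hinv : ∀ x ∈ (S : Set G), x⁻¹ ∈ (S : Set G) := fun x hx => hS.inv_mem x hx
  have hix : (i, x) ∈ commFrom (S : Set G) i := ⟨le_rfl, hx⟩
  have hjy : (j, y) ∈ commFrom (S : Set G) j := ⟨le_rfl, hy⟩
  have cX : Cost (commFrom (S : Set G) i) q 1 (x ^ a) := (Cost.pow hix a).mono (hscale a i ha)
  have cY : Cost (commFrom (S : Set G) j) q 1 (y ^ b) := (Cost.pow hjy b).mono (hscale b j hb)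
  obtain ⟨u, hu⟩ : ∃ u, u = gx⁻¹ * x ^ a := ⟨_, rfl⟩
  obtain ⟨v, hv⟩ : ∃ v, v = gy⁻¹ * y ^ b := ⟨_, rfl⟩
  rw [← hu] at chx
  rw [← hv] at chy
  have hX : x ^ a = gx * u := by rw [hu]; group
  have hY : y ^ b = gy * v := by rw [hv]; group
  have cgx : Cost (commFrom (S : Set G) i) q (1 + Cx) gx := by
    have := cX.mul' ((chx.inv (commFrom_inv hinv)).subset (commFrom_anti (Nat.le_succ i)))
    rwa [hX, mul_inv_cancel_right] at this
  have cP := (chx.commutator hq cY).conj_commFrom hq (hlen gx Kx hgx)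
  have cR := (cgx.commutator hq chy).conj_commFrom hq (hlen gy Ky hgy)
  have hwl : wordLength S ⁅gx, gy⁆ ≤ 2 * (Kx + Ky) * r := by
    have := hS.wordLength_commutator_le gx gy
    nlinarith
  have hV : ∀ v ∈ {v | ∃ k ≤ a, ∃ l ≤ b, v = x ^ k * y ^ l},
      Cost (commFrom (S : Set G) 1) q 2 v := by
    rintro v ⟨k, hk, l, hl, rfl⟩
    have c1 := ((Cost.pow (q := q) hix k).mono (hscale k i (hk.trans ha))).subset
      (commFrom_anti hx.pos)
    have c2 := ((Cost.pow (q := q) hjy l).mono (hscale l j (hl.trans hb))).subset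
      (commFrom_anti hy.pos)
    exact (c1.mul' c2).mono (by norm_num)
  have hab : ((a * b : ℕ) : ℝ) * q ^ (i + j) ≤ 1 :=
    hscale _ _ (by rw [pow_add]; exact Nat.mul_le_mul ha hb)
  have cH := ((conjProd_commutator_pow x y a b).cost hq hq1 (hx.comm hy) hV hab).inv
    (commFrom_inv hinv)
  refine ⟨⁅gx, gy⁆, hwl, ?_⟩
  rw [show i + 1 + j = i + j + 1 by omega] at cP
  have cg : Cost (commFrom (S : Set G) 1) q (2 * (Kx + Ky)) ⁅gx, gy⁆⁻¹ := by
    have := (hlen _ _ hwl).inv (commFrom_inv hinv)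
    exact_mod_cast this
  have cfin := ((cH.mul' cP).conj_commFrom hq cg).mul' cR
  have e1 : ⁅x ^ a, y ^ b⁆ =
      gx * ⁅u, y ^ b⁆ * gx⁻¹ * (⁅gx, gy⁆ * (gy * ⁅gx, v⁆ * gy⁻¹)) := by
    rw [hX, commutatorElement_mul_left_eq_conj_mul]
    congr 1
    rw [hY, commutatorElement_mul_right_eq_mul_conj]
    group
  have e2 : ⁅gx, gy⁆⁻¹ * ⁅x, y⁆ ^ (a * b) = ⁅gx, gy⁆⁻¹ *
      ((⁅x ^ a, y ^ b⁆ * (⁅x, y⁆ ^ (a * b))⁻¹)⁻¹ * (gx * ⁅u, y ^ b⁆ * gx⁻¹)) * ⁅gx, gy⁆⁻¹⁻¹ *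
      (gy * ⁅gx, v⁆ * gy⁻¹) := by
    rw [mul_inv_rev, inv_inv, e1]
    group
  rw [e2]
  have := mul_le_of_le_one_left (by positivity : 0 ≤ 2 * Real.exp 4) hab
  exact cfin.mono (by gcongr)

lemma IsComm.pow_approx (hS : IsSymmGen S) {w : ℕ} {x : G} (hx : IsComm (S : Set G) w x) :
    ∃ (K : ℕ) (C : ℝ), ∀ r : ℕ, 1 ≤ r → ∀ n ≤ r ^ w, ∃ g, wordLength S g ≤ K * r ∧
      Cost (commFrom (S : Set G) (w + 1)) (r : ℝ)⁻¹ C (g⁻¹ * x ^ n) := by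
  induction hx with
  | @base x h =>
    refine ⟨1, 0, fun r hr n hn => ⟨x ^ n, ?_, by simpa using Cost.one le_rfl⟩⟩
    have := wordLength_prod_le (S := S) (List.replicate n x)
      (fun y hy => by rwa [List.eq_of_mem_replicate hy])
    simp only [List.prod_replicate, List.length_replicate] at this
    linarith
  | @comm i j x y hx hy ihx ihy =>
    obtain ⟨Kx, Cx, ihx⟩ := ihx
    obtain ⟨Ky, Cy, ihy⟩ := ihy
    obtain ⟨K, C, h⟩ := commutator_pow_approx hS hx hy ihx ihy
    refine ⟨K + K, C * Real.exp K + C, fun r hr n hn => ?_⟩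
    have hrj : 0 < r ^ j := by positivity
    have hn1 : n / r ^ j ≤ r ^ i := Nat.div_le_of_le_mul (by rwa [← pow_add, add_comm j i])
    obtain ⟨g1, hg1, c1⟩ := h r hr (n / r ^ j) hn1 (r ^ j) le_rfl
    obtain ⟨g2, hg2, c2⟩ := h r hr 1 (Nat.one_le_pow _ _ hr) (n % r ^ j) (Nat.mod_lt _ hrj).le
    have hq : 0 ≤ (r : ℝ)⁻¹ := by positivity
    have cg : Cost (commFrom (S : Set G) 1) (r : ℝ)⁻¹ K g2⁻¹ := by
      refine ((hS.cost_of_wordLength _ g2).mono ?_).inv (commFrom_inv fun x hx => hS.inv_mem x hx)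
      rw [← div_eq_mul_inv, div_le_iff₀ (by exact_mod_cast hr)]
      exact_mod_cast hg2
    refine ⟨g1 * g2, (hS.wordLength_mul_le _ _).trans (by linarith), ?_⟩
    have := (c1.conj_commFrom hq cg).mul' c2
    convert this using 1
    conv_lhs => rw [← Nat.div_add_mod' n (r ^ j), pow_add]
    rw [one_mul]
    group

end WordLength

section Doubling

open scoped commutatorElement

variable {S : Finset G}

/-- Induction over the letters of weight at least `w`, from heavy to light. -/
lemma commFrom_induction (hG : Group.IsNilpotent G) (hS : IsSymmGen S) {P : Set (ℕ × G) → Prop}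
    (base : ∀ L : Set (ℕ × G), (∀ p ∈ L, p.2 = 1) → P L)
    (step : ∀ w t L, IsComm (S : Set G) w t → commFrom (S : Set G) (w + 1) ⊆ L →
      L ⊆ commFrom (S : Set G) w → P L → P (insert (w, t) (insert (w, t⁻¹) L))) (w : ℕ) :
    P (commFrom (S : Set G) w) := by
  obtain ⟨c, hc⟩ := exists_isComm_eq_one (S := (S : Set G)) hG
  suffices H : ∀ k w, c < w + k → P (commFrom (S : Set G) w) from H (c + 1) w (by omega)
  intro k
  induction k with
  | zero => exact fun w hw => base _ fun p hp => hc p.1 p.2 (hw.trans_le hp.1) hp.2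
  | succ k ih =>
    intro w hw
    have hP := ih (w + 1) (by omega)
    have hinv : ∀ x, IsComm (S : Set G) w x → IsComm (S : Set G) w x⁻¹ :=
      fun x hx => hx.inv fun y hy => hS.inv_mem y hy
    have main : P ({p | p.1 = w ∧ (p.2 ∈ {x | IsComm (S : Set G) w x} ∨
        p.2⁻¹ ∈ {x | IsComm (S : Set G) w x})} ∪ commFrom (S : Set G) (w + 1)) := by
      refine Set.Finite.induction_on_subset _ (finite_isComm (S.finite_toSet) w)
        (motive := fun A _ => P ({p | p.1 = w ∧ (p.2 ∈ A ∨ p.2⁻¹ ∈ A)} ∪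
          commFrom (S : Set G) (w + 1))) ?_ ?_
      · simpa using hP
      · intro t A ht hA _ hPA
        have h := step w t _ ht Set.subset_union_right ?_ hPA
        · convert h using 1
          ext ⟨i, x⟩
          simp only [Set.mem_insert_iff, Set.mem_union, Set.mem_ofPred_eq, Prod.mk.injEq,
            inv_eq_iff_eq_inv]
          tauto
        · rintro ⟨i, x⟩ (⟨rfl, h | h⟩ | h)
          · exact ⟨le_rfl, hA h⟩
          · exact ⟨le_rfl, by simpa using hinv _ (hA h)⟩
          · exact commFrom_anti (Nat.le_succ w) h
    convert main using 1
    ext ⟨i, x⟩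
    constructor
    · rintro ⟨h1, h2⟩
      rcases h1.eq_or_lt with rfl | h1
      · exact Or.inl ⟨rfl, Or.inl h2⟩
      · exact Or.inr ⟨h1, h2⟩
    · rintro (⟨rfl, h | h⟩ | h)
      · exact ⟨le_rfl, h⟩
      · exact ⟨le_rfl, by simpa using hinv _ h⟩
      · exact commFrom_anti (Nat.le_succ w) h

/-- Words over `L` of bounded cost at scale `r` have length `O(r)`. -/
def LengthBound (S : Finset G) (L : Set (ℕ × G)) : Prop :=
  ∀ C : ℝ, ∃ K : ℕ, ∀ r : ℕ, 1 ≤ r → ∀ g, Cost L (r : ℝ)⁻¹ C g → wordLength S g ≤ K * r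

lemma LengthBound.pow (hS : IsSymmGen S) {w : ℕ} {t : G} (ht : IsComm (S : Set G) w t)
    (h : LengthBound S (commFrom (S : Set G) (w + 1))) :
    ∃ K : ℕ, ∀ r : ℕ, 1 ≤ r → ∀ n ≤ r ^ w, wordLength S (t ^ n) ≤ K * r := by
  obtain ⟨K, C, hK⟩ := ht.pow_approx hS
  obtain ⟨K', hK'⟩ := h C
  refine ⟨K + K', fun r hr n hn => ?_⟩
  obtain ⟨g, hg, hc⟩ := hK r hr n hn
  have h1 := hS.wordLength_mul_le g (g⁻¹ * t ^ n)
  have h2 := hK' r hr _ hc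
  rw [mul_inv_cancel_left] at h1
  linarith

lemma lengthBound (hG : Group.IsNilpotent G) (hS : IsSymmGen S) (w : ℕ) :
    LengthBound S (commFrom (S : Set G) w) := by
  refine commFrom_induction hG hS (P := LengthBound S) ?_ ?_ w
  · intro L hL C
    exact ⟨0, fun r hr g hg => by simp [hg.eq_one hL]⟩
  · intro w t L ht hL1 hL2 hL C
    obtain ⟨K, hK⟩ := LengthBound.pow hS ht fun C => (hL C).imp
      fun K hK r hr g hg => hK r hr g (hg.subset hL1)
    obtain ⟨K', hK'⟩ := hL (C * Real.exp C)
    obtain ⟨M, hM⟩ := exists_nat_ge C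
    refine ⟨K' + K * (M + 1), fun r hr g hg => ?_⟩
    have hr0 : (0 : ℝ) < r := by exact_mod_cast hr
    obtain ⟨n, h, rfl, hn, hh⟩ :=
      hg.collect (fun x hx => hS.inv_mem x hx) (by positivity) ht hL1 hL2
    have hn' : n.natAbs ≤ ((M + 1) * r) ^ w := by
      have h1 : ((n.natAbs : ℕ) : ℝ) ≤ C * r ^ w := by
        rw [Nat.cast_natAbs]
        rwa [inv_pow, ← div_eq_mul_inv, div_le_iff₀ (by positivity)] at hn
      have h2 : ((n.natAbs : ℕ) : ℝ) ≤ ((((M + 1) * r) ^ w : ℕ) : ℝ) := by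
        refine h1.trans ?_
        push_cast
        rw [mul_pow]
        gcongr
        refine hM.trans ((by linarith : (M : ℝ) ≤ M + 1).trans ?_)
        exact le_self_pow₀ (by simp) (by have := ht.pos; omega)
      exact_mod_cast h2
    have hpow : wordLength S (t ^ n) ≤ K * ((M + 1) * r) := by
      have h1 := hK ((M + 1) * r) (Nat.mul_pos (Nat.succ_pos M) hr) _ hn'
      obtain h2 | h2 := n.natAbs_eq
      · rw [h2, zpow_natCast]
        exact h1
      · rw [h2, zpow_neg, zpow_natCast]
        exact (hS.wordLength_inv_le _).trans h1
    have := hS.wordLength_mul_le h (t ^ n)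
    have := hK' r hr h hh
    linarith

/-- Words over `L` of bounded cost at scale `r` are covered by boundedly many translates of
balls of radius `r / M`. -/
lemma exists_covering (hG : Group.IsNilpotent G) (hS : IsSymmGen S) (w : ℕ) (C : ℝ) (M : ℕ) :
    ∃ A : ℕ, ∀ r : ℕ, 1 ≤ r → ∃ F : Finset G, F.card ≤ A ∧
      ∀ g, Cost (commFrom (S : Set G) w) (r : ℝ)⁻¹ C g →
        ∃ f ∈ F, M * wordLength S (g * f⁻¹) ≤ r := by
  classical
  revert C M
  refine commFrom_induction hG hS (P := fun L => ∀ (C : ℝ) (M : ℕ), ∃ A : ℕ, ∀ r : ℕ, 1 ≤ r →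
    ∃ F : Finset G, F.card ≤ A ∧ ∀ g, Cost L (r : ℝ)⁻¹ C g →
      ∃ f ∈ F, M * wordLength S (g * f⁻¹) ≤ r) ?_ ?_ w
  · intro L hL C M
    refine ⟨1, fun r hr => ⟨{1}, by simp, fun g hg => ⟨1, by simp, ?_⟩⟩⟩
    simp [hg.eq_one hL]
  · intro w t L ht hL1 hL2 hL C M
    obtain ⟨K, hK⟩ := LengthBound.pow hS ht (lengthBound hG hS (w + 1))
    obtain ⟨A, hA⟩ := hL (C * Real.exp C * Real.exp 1) (2 * M)
    obtain ⟨N, hN⟩ := exists_nat_ge C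
    obtain ⟨D, hD⟩ : ∃ D, D = 2 * M * K + 1 := ⟨_, rfl⟩
    refine ⟨A * (2 * (N * (2 * D) ^ w) + 1), fun r hr => ?_⟩
    obtain ⟨F, hF, hcov⟩ := hA r hr
    have hr0 : (0 : ℝ) < r := by exact_mod_cast hr
    have hD0 : 0 < D := by omega
    obtain ⟨p, hp⟩ : ∃ p, p = max 1 (r / D) := ⟨_, rfl⟩
    have hp1 : 1 ≤ p := by omega
    have hpr : p ≤ r := by
      have := Nat.div_le_self r D
      omega
    have hrp : r ≤ 2 * D * p := by
      have h1 : r < D * (r / D + 1) := Nat.lt_mul_div_succ r hD0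
      have h2 : r / D + 1 ≤ 2 * p := by omega
      nlinarith [Nat.mul_le_mul_left D h2]
    have hQ : r ^ w ≤ (2 * D) ^ w * p ^ w := by
      rw [← mul_pow]
      exact Nat.pow_le_pow_left hrp w
    have hpw : (0 : ℤ) < (p ^ w : ℕ) := by positivity
    obtain ⟨Q, hQdef⟩ : ∃ Q, Q = N * (2 * D) ^ w := ⟨_, rfl⟩
    rw [← hQdef]
    refine ⟨Finset.image₂ (fun f (k : ℤ) => f * t ^ ((p ^ w : ℕ) * k)) F
      (Finset.Icc (-(Q : ℤ)) Q), ?_, fun g hg => ?_⟩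
    · refine (Finset.card_image₂_le _ _ _).trans (Nat.mul_le_mul hF ?_)
      rw [Int.card_Icc]
      omega
    obtain ⟨n, h, rfl, hn, hh⟩ :=
      hg.collect (fun x hx => hS.inv_mem x hx) (by positivity) ht hL1 hL2
    have hn' : |n| ≤ Q * (p ^ w : ℕ) := by
      have h1 : ((|n| : ℤ) : ℝ) ≤ C * r ^ w := by
        rwa [inv_pow, ← div_eq_mul_inv, div_le_iff₀ (by positivity)] at hn
      have h2 : ((|n| : ℤ) : ℝ) ≤ ((Q * (p ^ w : ℕ) : ℤ) : ℝ) := by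
        refine h1.trans ?_
        rw [hQdef]
        have h3 : (r : ℝ) ^ w ≤ (2 * D) ^ w * p ^ w := by exact_mod_cast hQ
        push_cast
        rw [mul_assoc]
        gcongr
      exact_mod_cast h2
    obtain ⟨s, hs⟩ : ∃ s : ℕ, (s : ℤ) = n % (p ^ w : ℕ) :=
      ⟨(n % (p ^ w : ℕ)).toNat, Int.toNat_of_nonneg (Int.emod_nonneg _ hpw.ne')⟩
    have hsp : s < p ^ w := by
      have := Int.emod_lt_of_pos n hpw
      rw [← hs] at this
      exact_mod_cast this
    have hts : 2 * M * wordLength S (t ^ s) ≤ r := by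
      by_cases hrD : r / D = 0
      · have hs0 : s = 0 := by
          rw [hp, hrD] at hsp
          simpa using hsp
        simp [hs0]
      · have hp' : p = r / D := by rw [hp]; exact max_eq_right (Nat.pos_of_ne_zero hrD)
        have h1 := hK p hp1 s hsp.le
        have h2 : p * D ≤ r := by rw [hp']; exact Nat.div_mul_le_self r D
        calc 2 * M * wordLength S (t ^ s) ≤ 2 * M * (K * p) := by gcongr
          _ ≤ p * D := by rw [hD]; nlinarith
          _ ≤ r := h2
    have htinv : IsComm (S : Set G) w t⁻¹ := ht.inv fun x hx => hS.inv_mem x hx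
    have hconj : Cost L (r : ℝ)⁻¹ (C * Real.exp C * Real.exp 1)
        ((t⁻¹) ^ s * h * ((t⁻¹) ^ s)⁻¹) := by
      refine hh.conj (M := commFrom (S : Set G) w) (by positivity) ?_ ?_
      · intro i x j y hx hy
        have := htinv.pos
        exact hL1 (commFrom_anti (by omega) (commFrom_comm i x j y (hL2 hx) hy))
      · refine (Cost.pow (show (w, t⁻¹) ∈ commFrom (S : Set G) w from ⟨le_rfl, htinv⟩) s).mono ?_
        rw [inv_pow, ← div_eq_mul_inv]
        refine div_le_one_of_le₀ ?_ (by positivity)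
        exact_mod_cast hsp.le.trans (Nat.pow_le_pow_left hpr w)
    obtain ⟨f, hf, hfr⟩ := hcov _ hconj
    refine ⟨f * t ^ ((p ^ w : ℕ) * (n / (p ^ w : ℕ))), ?_, ?_⟩
    · refine Finset.mem_image₂_of_mem hf (Finset.mem_Icc.2 ⟨?_, ?_⟩)
      · refine Int.le_ediv_of_mul_le hpw ?_
        have := neg_abs_le n
        linarith
      · refine Int.ediv_le_of_le_mul hpw ?_
        have := le_abs_self n
        linarith
    · have hnd : n = s + (p ^ w : ℕ) * (n / (p ^ w : ℕ)) := by
        rw [hs, Int.emod_add_mul_ediv]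
      have e : h * t ^ n * (f * t ^ ((p ^ w : ℕ) * (n / (p ^ w : ℕ))))⁻¹ =
          t ^ s * ((t⁻¹) ^ s * h * ((t⁻¹) ^ s)⁻¹ * f⁻¹) := by
        conv_lhs => enter [1, 2]; rw [hnd]
        rw [zpow_add, zpow_natCast, inv_pow]
        group
      rw [e]
      have := Nat.mul_le_mul_left M (hS.wordLength_mul_le (t ^ s)
        ((t⁻¹) ^ s * h * ((t⁻¹) ^ s)⁻¹ * f⁻¹))
      nlinarith

lemma IsSymmGen.finite_ball (hS : IsSymmGen S) (r : ℕ) : {g | wordLength S g ≤ r}.Finite := by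
  refine (List.finite_length_le {x // x ∈ S} r |>.image
    fun l => (l.map Subtype.val).prod).subset ?_
  intro g hg
  obtain ⟨l, hl, hl', rfl⟩ := hS.exists_word g
  refine ⟨l.attach.map fun x => ⟨x.1, hl' x.1 x.2⟩, ?_, ?_⟩
  · simpa [hl] using hg
  · simp

/-- The ball of radius `r` around the identity in the word metric. -/
noncomputable def IsSymmGen.ball (hS : IsSymmGen S) (r : ℕ) : Finset G :=
  (hS.finite_ball r).toFinset

@[simp] lemma IsSymmGen.mem_ball (hS : IsSymmGen S) {r : ℕ} {g : G} :
    g ∈ hS.ball r ↔ wordLength S g ≤ r := by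
  simp [IsSymmGen.ball]

lemma IsSymmGen.card_ball_pos (hS : IsSymmGen S) (r : ℕ) : 0 < (hS.ball r).card :=
  Finset.card_pos.2 ⟨1, by simp⟩

/-- Nilpotent groups have the volume doubling property. -/
theorem IsSymmGen.exists_doubling (hS : IsSymmGen S) (hG : Group.IsNilpotent G) :
    ∃ A : ℕ, ∀ r : ℕ, 1 ≤ r → (hS.ball (2 * r)).card ≤ A * (hS.ball r).card := by
  classical
  obtain ⟨A, hA⟩ := exists_covering hG hS 1 2 1
  refine ⟨A, fun r hr => ?_⟩
  obtain ⟨F, hF, hcov⟩ := hA r hr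
  have hr0 : (0 : ℝ) < r := by exact_mod_cast hr
  have hsub : hS.ball (2 * r) ⊆ Finset.image₂ (fun f b => b * f) F (hS.ball r) := by
    intro g hg
    rw [hS.mem_ball] at hg
    obtain ⟨f, hf, hfr⟩ := hcov g ((hS.cost_of_wordLength _ g).mono (by
      rw [← div_eq_mul_inv, div_le_iff₀ hr0]
      exact_mod_cast hg))
    exact Finset.mem_image₂.2 ⟨f, hf, g * f⁻¹, by simpa using hfr, by group⟩
  calc _ ≤ _ := Finset.card_le_card hsub
    _ ≤ _ := Finset.card_image₂_le _ _ _
    _ ≤ _ := Nat.mul_le_mul_right _ hF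

end Doubling

section Walk

variable {S : Finset G}

omit [Group G] in
lemma summable_of_eq_zero {u v f : G → ℝ} (hu : u.HasFiniteSupport) (hv : v.HasFiniteSupport)
    (h : ∀ x, u x = 0 → v x = 0 → f x = 0) : Summable f := by
  refine summable_of_hasFiniteSupport ((hu.union hv).subset fun x hx => ?_)
  by_contra hx'
  simp only [Set.mem_union, Function.mem_support, not_or, not_not] at hx'
  exact hx (h x hx'.1 hx'.2)

lemma hasFiniteSupport_mul_right {u : G → ℝ} (hu : u.HasFiniteSupport) (g : G) :
    (fun x => u (x * g)).HasFiniteSupport :=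
  hu.fun_comp_of_injective (mul_left_injective g)

/-- The transition operator of the simple random walk with lazy letters over `S`. -/
noncomputable def lazyStep (S : Finset G) (f : G → ℝ) (x : G) : ℝ :=
  (∑ a : Option {x // x ∈ S}, f (x * lazyVal a)) / (S.card + 1)

/-- The distribution of the lazy random walk after `k` steps. -/
noncomputable def heat (S : Finset G) (k : ℕ) : G → ℝ :=
  (lazyStep S)^[k] (Set.indicator {1} 1)

omit [Group G] in
lemma card_letters : (Fintype.card (Option {x // x ∈ S}) : ℝ) = S.card + 1 := by
  simp

lemma sum_lazyVal (F : G → ℝ) :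
    ∑ a : Option {x // x ∈ S}, F (lazyVal a) = F 1 + ∑ x ∈ S, F x := by
  simp [Fintype.sum_option, lazyVal, Finset.sum_attach]

lemma IsSymmGen.sum_lazyVal_inv (hS : IsSymmGen S) (F : G → ℝ) :
    ∑ a : Option {x // x ∈ S}, F (lazyVal a)⁻¹ = ∑ a : Option {x // x ∈ S}, F (lazyVal a) := by
  rw [sum_lazyVal, sum_lazyVal fun x => F x⁻¹, inv_one]
  congr 1
  exact Finset.sum_nbij' (·⁻¹) (·⁻¹) (fun x hx => hS.inv_mem x hx) (fun x hx => hS.inv_mem x hx)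
    (by simp) (by simp) (by simp)

/-- Reversing the edges of the Cayley graph preserves sums over edges. -/
lemma IsSymmGen.sum_edge_swap (hS : IsSymmGen S) (F : G → G → ℝ) :
    ∑ a : Option {x // x ∈ S}, ∑' x, F x (x * lazyVal a) =
      ∑ a : Option {x // x ∈ S}, ∑' x, F (x * lazyVal a) x := by
  rw [← hS.sum_lazyVal_inv fun g => ∑' x, F x (x * g)]
  refine Finset.sum_congr rfl fun a _ => ?_
  rw [← (Equiv.mulRight (lazyVal a)).tsum_eq]
  simp

lemma lazyStep_hasFiniteSupport {f : G → ℝ} (hf : f.HasFiniteSupport) :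
    (lazyStep S f).HasFiniteSupport := by
  have h : (fun x => ∑ a : Option {x // x ∈ S}, f (x * lazyVal a)).HasFiniteSupport := by
    refine (Set.finite_iUnion fun a : Option {x // x ∈ S} =>
      hasFiniteSupport_mul_right hf (lazyVal a)).subset fun x hx => ?_
    obtain ⟨a, -, ha⟩ := Finset.exists_ne_zero_of_sum_ne_zero hx
    exact Set.mem_iUnion.2 ⟨a, ha⟩
  refine h.subset fun x hx => ?_
  rintro h0
  exact hx (by simp only [lazyStep]; exact div_eq_zero_iff.2 (Or.inl h0))

/-- The transition operator is self-adjoint. -/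
lemma IsSymmGen.tsum_mul_lazyStep (hS : IsSymmGen S) {f : G → ℝ} (hf : f.HasFiniteSupport)
    (g : G → ℝ) : ∑' x, f x * lazyStep S g x = ∑' x, lazyStep S f x * g x := by
  simp only [lazyStep, mul_div_assoc', div_mul_eq_mul_div, Finset.mul_sum, Finset.sum_mul,
    tsum_div_const]
  rw [Summable.tsum_finsetSum, Summable.tsum_finsetSum, hS.sum_edge_swap fun x y => f x * g y]
  · exact fun a _ => summable_of_eq_zero (hasFiniteSupport_mul_right hf (lazyVal a)) hf
      fun x h _ => by simp [h]
  · exact fun a _ => summable_of_eq_zero hf hf fun x h _ => by simp [h]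

lemma heat_zero : heat S 0 = Set.indicator {1} 1 := rfl

lemma heat_succ (k : ℕ) : heat S (k + 1) = lazyStep S (heat S k) :=
  Function.iterate_succ_apply' _ _ _

lemma heat_add (i j : ℕ) : (lazyStep S)^[i] (heat S j) = heat S (i + j) := by
  rw [heat, heat, Function.iterate_add_apply]

lemma heat_hasFiniteSupport (k : ℕ) : (heat S k).HasFiniteSupport := by
  induction k with
  | zero => exact (Set.finite_singleton (1 : G)).subset Set.support_indicator_subset
  | succ k ih => rw [heat_succ]; exact lazyStep_hasFiniteSupport ih

lemma lazyStep_nonneg {f : G → ℝ} (hf : ∀ x, 0 ≤ f x) (x : G) : 0 ≤ lazyStep S f x :=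
  div_nonneg (Finset.sum_nonneg fun _ _ => hf _) (by positivity)

lemma heat_nonneg (k : ℕ) (x : G) : 0 ≤ heat S k x := by
  induction k generalizing x with
  | zero => exact Set.indicator_nonneg (by simp) x
  | succ k ih => rw [heat_succ]; exact lazyStep_nonneg ih x

/-- The distribution of the walk computes the powers of the transition operator. -/
lemma IsSymmGen.tsum_heat_mul (hS : IsSymmGen S) (k : ℕ) (f : G → ℝ) :
    ∑' x, heat S k x * f x = (lazyStep S)^[k] f 1 := by
  induction k generalizing f with
  | zero =>
    rw [tsum_eq_single 1]
    · simp [heat_zero]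
    · intro x hx
      simp [heat_zero, hx]
  | succ k ih =>
    rw [Function.iterate_succ_apply, ← ih, hS.tsum_mul_lazyStep (heat_hasFiniteSupport k),
      heat_succ]

lemma IsSymmGen.tsum_heat (hS : IsSymmGen S) (k : ℕ) : ∑' x, heat S k x = 1 := by
  have h1 : lazyStep S (1 : G → ℝ) = 1 := by
    ext x
    simp only [lazyStep, Pi.one_apply, Finset.sum_const, Finset.card_univ, nsmul_eq_mul, mul_one]
    rw [card_letters, div_self (by positivity)]
  simpa [Function.iterate_fixed h1] using hS.tsum_heat_mul k 1

lemma iterate_lazyStep_mul_left (k : ℕ) (f : G → ℝ) (h x : G) :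
    (lazyStep S)^[k] (fun y => f (h * y)) x = (lazyStep S)^[k] f (h * x) := by
  induction k generalizing x with
  | zero => rfl
  | succ k ih => simp only [Function.iterate_succ_apply', lazyStep, ih, mul_assoc]

lemma IsSymmGen.tsum_heat_mul_heat_mul_left (hS : IsSymmGen S) (i j : ℕ) (h : G) :
    ∑' x, heat S i x * heat S j (h * x) = heat S (i + j) h := by
  rw [hS.tsum_heat_mul i fun x => heat S j (h * x), iterate_lazyStep_mul_left, heat_add, mul_one]

lemma IsSymmGen.tsum_heat_mul_heat (hS : IsSymmGen S) (i j : ℕ) :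
    ∑' x, heat S i x * heat S j x = heat S (i + j) 1 := by
  simpa using hS.tsum_heat_mul_heat_mul_left i j 1

lemma IsSymmGen.tsum_heat_sq (hS : IsSymmGen S) (k : ℕ) :
    ∑' x, heat S k x ^ 2 = heat S (2 * k) 1 := by
  simp only [pow_two, hS.tsum_heat_mul_heat, two_mul]

omit [Group G] in
/-- The Cauchy–Schwarz inequality for finitely supported functions. -/
lemma tsum_mul_sq_le {f g : G → ℝ} (hf : f.HasFiniteSupport) :
    (∑' x, f x * g x) ^ 2 ≤ (∑' x, f x ^ 2) * ∑ x ∈ hf.toFinset, g x ^ 2 := by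
  have h0 : ∀ x ∉ hf.toFinset, f x = 0 := fun x hx =>
    Function.notMem_support.1 fun h => hx (hf.mem_toFinset.2 h)
  rw [tsum_eq_sum (s := hf.toFinset) fun x hx => by simp [h0 x hx],
    tsum_eq_sum (s := hf.toFinset) fun x hx => by simp [h0 x hx]]
  exact Finset.sum_mul_sq_le_sq_mul_sq _ _ _

lemma heat_add_one_ge (k : ℕ) (x : G) : heat S k x ≤ (S.card + 1) * heat S (k + 1) x := by
  rw [heat_succ, lazyStep, mul_div_cancel₀ _ (by positivity)]
  have := Finset.single_le_sum (f := fun a : Option {x // x ∈ S} => heat S k (x * lazyVal a))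
    (fun a _ => heat_nonneg k _) (Finset.mem_univ none)
  simpa [lazyVal] using this

lemma IsSymmGen.heat_two_mul_le (hS : IsSymmGen S) (k : ℕ) (g : G) :
    heat S (2 * k) g ≤ heat S (2 * k) 1 := by
  have h1 : ∀ x, heat S k x * heat S k (g * x) ≤ (heat S k x ^ 2 + heat S k (g * x) ^ 2) / 2 :=
    fun x => by nlinarith [sq_nonneg (heat S k x - heat S k (g * x))]
  have hs1 : (fun x => heat S k (g * x)).HasFiniteSupport :=
    (heat_hasFiniteSupport k).fun_comp_of_injective (mul_right_injective g)
  have hs := heat_hasFiniteSupport (S := S) k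
  have h2 : ∑' x, heat S k (g * x) ^ 2 = ∑' x, heat S k x ^ 2 :=
    (Equiv.mulLeft g).tsum_eq fun x => heat S k x ^ 2
  calc heat S (2 * k) g = ∑' x, heat S k x * heat S k (g * x) := by
        rw [hS.tsum_heat_mul_heat_mul_left, two_mul]
    _ ≤ ∑' x, (heat S k x ^ 2 + heat S k (g * x) ^ 2) / 2 :=
        Summable.tsum_le_tsum h1 (summable_of_eq_zero hs hs1 fun x h h' => by simp [h])
          (summable_of_eq_zero hs hs1 fun x h h' => by simp [h, h'])
    _ = heat S (2 * k) 1 := by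
        rw [tsum_div_const, Summable.tsum_add
          (summable_of_eq_zero hs hs fun x h h' => by simp [h])
          (summable_of_eq_zero hs1 hs1 fun x h h' => by simp [h]), h2, hS.tsum_heat_sq]
        ring

lemma IsSymmGen.heat_le (hS : IsSymmGen S) (k : ℕ) (g : G) :
    heat S k g ≤ heat S (2 * (k / 2)) 1 := by
  obtain h | h := Nat.mod_two_eq_zero_or_one k
  · have : 2 * (k / 2) = k := by omega
    have h1 := hS.heat_two_mul_le (k / 2) g
    rwa [this] at h1 ⊢
  · have : k = 2 * (k / 2) + 1 := by omega
    conv_lhs => rw [this]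
    rw [heat_succ, lazyStep, div_le_iff₀ (Nat.cast_add_one_pos _), ← card_letters (S := S)]
    refine (Finset.sum_le_card_nsmul _ _ _ fun a _ => hS.heat_two_mul_le _ _).trans_eq ?_
    rw [nsmul_eq_mul, mul_comm, Finset.card_univ]

lemma heat_two_mul_half_le (k : ℕ) :
    heat S (2 * (k / 2)) 1 ≤ (S.card + 1) * heat S k 1 := by
  obtain h | h := Nat.mod_two_eq_zero_or_one k
  · have : 2 * (k / 2) = k := by omega
    rw [this]
    nlinarith [heat_nonneg (S := S) k 1, Nat.cast_nonneg (α := ℝ) S.card]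
  · have : k = 2 * (k / 2) + 1 := by omega
    conv_rhs => rw [this]
    exact heat_add_one_ge _ _

end Walk

section Energy

variable {S : Finset G}

/-- The sum of `F` over the oriented edges of the Cayley graph, loops included. -/
noncomputable def edgeSum (S : Finset G) (F : G → G → ℝ) : ℝ :=
  ∑ a : Option {x // x ∈ S}, ∑' x, F x (x * lazyVal a)

lemma summable_edge {u : G → ℝ} (hu : u.HasFiniteSupport) {F : G → G → ℝ}
    (hF : ∀ x y, u x = 0 → u y = 0 → F x y = 0) (g : G) : Summable fun x => F x (x * g) :=
  summable_of_eq_zero hu (hasFiniteSupport_mul_right hu g) fun _ h h' => hF _ _ h h'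

lemma edgeSum_add {u : G → ℝ} (hu : u.HasFiniteSupport) {F F' : G → G → ℝ}
    (hF : ∀ x y, u x = 0 → u y = 0 → F x y = 0) (hF' : ∀ x y, u x = 0 → u y = 0 → F' x y = 0) :
    edgeSum S (fun x y => F x y + F' x y) = edgeSum S F + edgeSum S F' := by
  rw [edgeSum, edgeSum, edgeSum, ← Finset.sum_add_distrib]
  exact Finset.sum_congr rfl fun a _ =>
    Summable.tsum_add (summable_edge hu hF _) (summable_edge hu hF' _)

lemma edgeSum_mul (c : ℝ) (F : G → G → ℝ) :
    edgeSum S (fun x y => c * F x y) = c * edgeSum S F := by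
  simp only [edgeSum, tsum_mul_left, Finset.mul_sum]

lemma edgeSum_mono {u : G → ℝ} (hu : u.HasFiniteSupport) {F F' : G → G → ℝ}
    (hF : ∀ x y, u x = 0 → u y = 0 → F x y = 0) (hF' : ∀ x y, u x = 0 → u y = 0 → F' x y = 0)
    (h : ∀ x, ∀ a : Option {x // x ∈ S}, F x (x * lazyVal a) ≤ F' x (x * lazyVal a)) :
    edgeSum S F ≤ edgeSum S F' :=
  Finset.sum_le_sum fun a _ => Summable.tsum_le_tsum (fun x => h x a)
    (summable_edge hu hF _) (summable_edge hu hF' _)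

lemma edgeSum_left (f : G → ℝ) : edgeSum S (fun x _ => f x) = (S.card + 1) * ∑' x, f x := by
  simp [edgeSum]

lemma IsSymmGen.edgeSum_swap (hS : IsSymmGen S) (F : G → G → ℝ) :
    edgeSum S (fun x y => F y x) = edgeSum S F :=
  hS.sum_edge_swap fun x y => F y x

lemma IsSymmGen.edgeSum_right (hS : IsSymmGen S) (f : G → ℝ) :
    edgeSum S (fun _ y => f y) = (S.card + 1) * ∑' x, f x := by
  rw [hS.edgeSum_swap fun x _ => f x, edgeSum_left]

lemma lazyStep_sq_le (u : G → ℝ) (x : G) :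
    (S.card + 1) ^ 2 * lazyStep S u x ^ 2 ≤
      ∑ a : Option {x // x ∈ S}, ((S.card + 1) * u (x * lazyVal a) ^ 2 -
        (u (x * lazyVal a) - u x) ^ 2) := by
  have h1 : ((S.card : ℝ) + 1) * lazyStep S u x = u x + ∑ s ∈ S, u (x * s) := by
    rw [lazyStep, mul_div_cancel₀ _ (by positivity), sum_lazyVal fun g => u (x * g), mul_one]
  have h2 : (∑ s ∈ S, (u (x * s) - u x)) ^ 2 ≤ S.card * ∑ s ∈ S, (u (x * s) - u x) ^ 2 :=
    sq_sum_le_card_mul_sum_sq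
  have h3 : ∑ s ∈ S, (u (x * s) - u x) = ∑ s ∈ S, u (x * s) - S.card * u x := by
    simp [Finset.sum_sub_distrib]
  have h4 : ∑ s ∈ S, u (x * s) ^ 2 =
      ∑ s ∈ S, (u (x * s) - u x) ^ 2 + 2 * u x * ∑ s ∈ S, u (x * s) - S.card * u x ^ 2 := by
    rw [Finset.mul_sum, ← Finset.sum_add_distrib, eq_sub_iff_add_eq, ← nsmul_eq_mul,
      ← Finset.sum_const, ← Finset.sum_add_distrib]
    exact Finset.sum_congr rfl fun s _ => by ring
  rw [sum_lazyVal fun g => (S.card + 1) * u (x * g) ^ 2 - (u (x * g) - u x) ^ 2, ← mul_pow, h1,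
    Finset.sum_sub_distrib, ← Finset.mul_sum, h4]
  rw [h3] at h2
  simp only [mul_one, sub_self]
  nlinarith [h2]

/-- One step of the walk decreases the weighted `ℓ²` energy. -/
lemma weighted_lazyStep_sq_le {u : G → ℝ} (hu : u.HasFiniteSupport) {W : G → ℝ}
    (hW : ∀ x, 0 ≤ W x) :
    (S.card + 1) ^ 2 * ∑' x, W x * lazyStep S u x ^ 2 +
        edgeSum S (fun x y => W x * (u y - u x) ^ 2) ≤
      (S.card + 1) * edgeSum S (fun x y => W x * u y ^ 2) := by
  have hPu := lazyStep_hasFiniteSupport (S := S) hu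
  rw [← edgeSum_mul]
  refine le_sub_iff_add_le.1 ?_
  have key : (S.card + 1 : ℝ) ^ 2 * ∑' x, W x * lazyStep S u x ^ 2 ≤
      edgeSum S fun x y => W x * ((S.card + 1) * u y ^ 2 - (u y - u x) ^ 2) := by
    have hs : ∀ a : Option {x // x ∈ S}, Summable fun x => W x *
        ((S.card + 1) * u (x * lazyVal a) ^ 2 - (u (x * lazyVal a) - u x) ^ 2) := fun a =>
      summable_edge hu (F := fun x y => W x * ((S.card + 1) * u y ^ 2 - (u y - u x) ^ 2))
        (fun x y h h' => by simp [h, h']) _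
    rw [edgeSum, ← Summable.tsum_finsetSum fun a _ => hs a, ← tsum_mul_left]
    refine Summable.tsum_le_tsum (fun x => ?_) (summable_of_eq_zero hPu hPu fun x h _ => by
      simp [h]) (summable_sum fun a _ => hs a)
    rw [← Finset.mul_sum, mul_left_comm]
    exact mul_le_mul_of_nonneg_left (lazyStep_sq_le u x) (hW x)
  refine key.trans_eq (eq_sub_of_add_eq ?_)
  rw [← edgeSum_add hu (fun x y h h' => by simp [h, h']) (fun x y h h' => by simp [h, h'])]
  congr 1
  ext x y
  ring

/-- The Dirichlet energy of `u`. -/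
noncomputable def energy (S : Finset G) (u : G → ℝ) : ℝ :=
  edgeSum S fun x y => (u y - u x) ^ 2

lemma energy_nonneg (u : G → ℝ) : 0 ≤ energy S u :=
  Finset.sum_nonneg fun _ _ => tsum_nonneg fun _ => sq_nonneg _

lemma IsSymmGen.energy_le (hS : IsSymmGen S) {u : G → ℝ} (hu : u.HasFiniteSupport) :
    energy S u ≤ (S.card + 1) ^ 2 * (∑' x, u x ^ 2 - ∑' x, lazyStep S u x ^ 2) := by
  have h := weighted_lazyStep_sq_le (S := S) hu (W := fun _ => 1) (by simp)
  simp only [one_mul] at h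
  rw [hS.edgeSum_right fun y => u y ^ 2] at h
  rw [energy]
  linarith

lemma mul_sub_sq_le {W W' N η : ℝ} (u u' : ℝ) (hW : 0 < W) (h : |W' - W| ≤ η * W)
    (h' : |W' - W| ≤ η * W') :
    N * ((W' - W) * (u ^ 2 - u' ^ 2)) ≤
      2 * (W * (u' - u) ^ 2) + N ^ 2 * η ^ 2 / 4 * (W * u ^ 2 + W' * u' ^ 2) := by
  have h1 : (W' - W) ^ 2 ≤ η ^ 2 * W * W := by
    rw [← sq_abs]
    nlinarith [abs_nonneg (W' - W)]
  have h2 : (W' - W) ^ 2 ≤ η ^ 2 * W * W' := by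
    rw [← sq_abs]
    nlinarith [abs_nonneg (W' - W)]
  have h3 : W * (N * ((W' - W) * (u ^ 2 - u' ^ 2))) ≤
      2 * W ^ 2 * (u' - u) ^ 2 + N ^ 2 / 8 * ((W' - W) ^ 2 * (u + u') ^ 2) := by
    nlinarith [sq_nonneg (W * (u' - u) + N / 4 * ((W' - W) * (u + u')))]
  have h4 : (W' - W) ^ 2 * (u + u') ^ 2 ≤ 2 * (η ^ 2 * W * (W * u ^ 2 + W' * u' ^ 2)) := by
    have h5 : (u + u') ^ 2 ≤ 2 * (u ^ 2 + u' ^ 2) := by nlinarith [sq_nonneg (u - u')]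
    have h6 := mul_le_mul_of_nonneg_left h5 (sq_nonneg (W' - W))
    have h7 := mul_le_mul_of_nonneg_right h1 (sq_nonneg u)
    have h8 := mul_le_mul_of_nonneg_right h2 (sq_nonneg u')
    linarith
  have h5 := mul_le_mul_of_nonneg_left h4 (show 0 ≤ N ^ 2 / 8 by positivity)
  refine le_of_mul_le_mul_left ?_ hW
  linarith

/-- One step of the walk hardly increases `ℓ²` norms with slowly varying weights. -/
lemma IsSymmGen.weighted_lazyStep_le (hS : IsSymmGen S) {u : G → ℝ} (hu : u.HasFiniteSupport)
    {W : G → ℝ} (hW : ∀ x, 0 < W x) {η : ℝ}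
    (hη : ∀ x, ∀ a : Option {x // x ∈ S}, |W (x * lazyVal a) - W x| ≤ η * W x ∧
      |W (x * lazyVal a) - W x| ≤ η * W (x * lazyVal a)) :
    ∑' x, W x * lazyStep S u x ^ 2 ≤
      (1 + (S.card + 1) * η ^ 2 / 4) * ∑' x, W x * u x ^ 2 := by
  obtain ⟨N, hN⟩ : ∃ N : ℝ, N = S.card + 1 := ⟨_, rfl⟩
  have hN0 : 0 < N := by rw [hN]; positivity
  have h1 := weighted_lazyStep_sq_le (S := S) hu (W := W) fun x => (hW x).le
  have h2 : edgeSum S (fun x y => N * ((W y - W x) * (u x ^ 2 - u y ^ 2))) ≤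
      edgeSum S fun x y => 2 * (W x * (u y - u x) ^ 2) +
        N ^ 2 * η ^ 2 / 4 * (W x * u x ^ 2 + W y * u y ^ 2) :=
    edgeSum_mono hu (fun x y h h' => by simp [h, h']) (fun x y h h' => by simp [h, h'])
      fun x a => mul_sub_sq_le _ _ (hW x) (hη x a).1 (hη x a).2
  have h3 : edgeSum S (fun x y => N * ((W y - W x) * (u x ^ 2 - u y ^ 2))) =
      N * (2 * edgeSum S (fun x y => W x * u y ^ 2) - 2 * (N * ∑' x, W x * u x ^ 2)) := by
    have e : (fun x y => (W y - W x) * (u x ^ 2 - u y ^ 2)) = fun x y =>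
        (W y * u x ^ 2 + W x * u y ^ 2) + (-1) * (W x * u x ^ 2 + W y * u y ^ 2) := by
      ext x y
      ring
    rw [edgeSum_mul, e, edgeSum_add hu (fun x y h h' => by simp [h, h'])
      (fun x y h h' => by simp [h, h']), edgeSum_mul,
      edgeSum_add hu (fun x y h _ => by simp [h]) (fun x y _ h => by simp [h]),
      edgeSum_add hu (fun x y h _ => by simp [h]) (fun x y _ h => by simp [h]),
      hS.edgeSum_swap fun x y => W x * u y ^ 2, edgeSum_left fun x => W x * u x ^ 2,
      hS.edgeSum_right fun x => W x * u x ^ 2, ← hN]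
    ring
  rw [h3, edgeSum_add hu (fun x y h h' => by simp [h, h']) (fun x y h h' => by simp [h, h']),
    edgeSum_mul, edgeSum_mul,
    edgeSum_add hu (fun x y h _ => by simp [h]) (fun x y _ h => by simp [h]),
    edgeSum_left fun x => W x * u x ^ 2, hS.edgeSum_right fun x => W x * u x ^ 2, ← hN] at h2
  rw [← hN] at h1 ⊢
  refine le_of_mul_le_mul_left ?_ (show 0 < N ^ 2 by positivity)
  linarith

/-- Translation by `y` moves `u` by at most its energy times the squared length of `y`. -/
lemma tsum_translate_sub_sq_le {u : G → ℝ} (hu : u.HasFiniteSupport) (l : List G)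
    (hl : ∀ x ∈ l, x ∈ S) :
    ∑' x, (u (x * l.prod) - u x) ^ 2 ≤ (l.length : ℝ) ^ 2 * energy S u := by
  induction l with
  | nil => simp
  | cons s l ih =>
    specialize ih fun x hx => hl x (List.mem_cons_of_mem _ hx)
    have hs : s ∈ S := hl s List.mem_cons_self
    have hsumm : ∀ g, Summable fun x => (u (x * g) - u x) ^ 2 := fun g =>
      summable_edge hu (F := fun x y => (u y - u x) ^ 2) (fun x y h h' => by simp [h, h']) g
    have h1 : ∑' x, (u (x * s) - u x) ^ 2 ≤ energy S u := by
      have := Finset.single_le_sum (f := fun a : Option {x // x ∈ S} =>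
        ∑' x, (u (x * lazyVal a) - u x) ^ 2)
        (fun a _ => tsum_nonneg fun _ => sq_nonneg _) (Finset.mem_univ (some ⟨s, hs⟩))
      simpa [lazyVal, energy, edgeSum] using this
    have hsumm' : Summable fun x => (u (x * s * l.prod) - u (x * s)) ^ 2 :=
      ((Equiv.mulRight s).summable_iff (f := fun x => (u (x * l.prod) - u x) ^ 2)).2 (hsumm _)
    have h2 : ∑' x, (u (x * s * l.prod) - u (x * s)) ^ 2 = ∑' x, (u (x * l.prod) - u x) ^ 2 :=
      (Equiv.mulRight s).tsum_eq fun x => (u (x * l.prod) - u x) ^ 2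
    rw [List.prod_cons, List.length_cons, Nat.cast_add_one]
    obtain ⟨k, hk⟩ : ∃ k : ℝ, k = l.length := ⟨_, rfl⟩
    have hk0 : 0 ≤ k := by rw [hk]; positivity
    rw [← hk] at ih ⊢
    obtain rfl | hk1 := hk0.eq_or_lt
    · have : l = [] := by simpa [eq_comm] using hk
      subst this
      simpa using h1
    have h3 : ∑' x, k * (u (x * (s * l.prod)) - u x) ^ 2 ≤
        ∑' x, ((k + 1) * (u (x * s * l.prod) - u (x * s)) ^ 2 +
          k * (k + 1) * (u (x * s) - u x) ^ 2) := by
      refine Summable.tsum_le_tsum (fun x => ?_) ((hsumm _).mul_left _)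
        ((hsumm'.mul_left _).add ((hsumm _).mul_left _))
      rw [← mul_assoc]
      nlinarith [sq_nonneg ((u (x * s * l.prod) - u (x * s)) - k * (u (x * s) - u x))]
    rw [Summable.tsum_add (hsumm'.mul_left _) ((hsumm _).mul_left _), tsum_mul_left, tsum_mul_left,
      tsum_mul_left, h2] at h3
    refine le_of_mul_le_mul_left ?_ hk1
    have h4 := mul_le_mul_of_nonneg_left ih (show 0 ≤ k + 1 by positivity)
    have h5 := mul_le_mul_of_nonneg_left h1 (show 0 ≤ k * (k + 1) by positivity)
    linarith

/-- A Nash-type inequality. -/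
lemma IsSymmGen.tsum_sq_le (hS : IsSymmGen S) {u : G → ℝ} (hu : u.HasFiniteSupport)
    (hu0 : ∀ x, 0 ≤ u x) (hu1 : ∑' x, u x = 1) (r : ℕ) :
    ∑' x, u x ^ 2 ≤ 2 / (hS.ball r).card + (r : ℝ) ^ 2 * energy S u := by
  have hV : (0 : ℝ) < (hS.ball r).card := by exact_mod_cast hS.card_ball_pos r
  have hsu : Summable u := summable_of_eq_zero hu hu fun x h _ => h
  have h1 : ∀ y ∈ hS.ball r, ∑' x, u x ^ 2 - (r : ℝ) ^ 2 * energy S u ≤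
      2 * ∑' x, u x * u (x * y) := by
    intro y hy
    have hr : (wordLength S y : ℝ) ≤ r := by exact_mod_cast hS.mem_ball.1 hy
    obtain ⟨l, hl, hl', hly⟩ := hS.exists_word y
    have h2 : ∑' x, (u (x * y) - u x) ^ 2 ≤ (r : ℝ) ^ 2 * energy S u := by
      have := tsum_translate_sub_sq_le hu l hl'
      rw [hly, hl] at this
      refine this.trans ?_
      gcongr
      exact energy_nonneg u
    have h3 : ∑' x, u (x * y) ^ 2 = ∑' x, u x ^ 2 :=
      (Equiv.mulRight y).tsum_eq fun x => u x ^ 2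
    have huy := hasFiniteSupport_mul_right hu y
    have h4 : ∑' x, (u (x * y) - u x) ^ 2 + 2 * ∑' x, u x * u (x * y) =
        ∑' x, u (x * y) ^ 2 + ∑' x, u x ^ 2 := by
      rw [← tsum_mul_left, ← Summable.tsum_add, ← Summable.tsum_add]
      · exact tsum_congr fun x => by ring
      all_goals exact summable_of_eq_zero hu huy fun x h h' => by simp [h, h']
    have h5 : 0 ≤ ∑' x, u x ^ 2 := tsum_nonneg fun _ => sq_nonneg _
    linarith
  have h2 : ∑ y ∈ hS.ball r, ∑' x, u x * u (x * y) ≤ 1 := by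
    have hs : ∀ y, Summable fun x => u x * u (x * y) := fun y =>
      summable_of_eq_zero hu hu fun x h _ => by simp [h]
    rw [← Summable.tsum_finsetSum fun y _ => hs y, ← hu1]
    refine Summable.tsum_le_tsum (fun x => ?_) (summable_sum fun y _ => hs y) hsu
    rw [← Finset.mul_sum]
    refine mul_le_of_le_one_right (hu0 x) ?_
    have hxs : Summable fun y => u (x * y) :=
      ((Equiv.mulLeft x).summable_iff (f := u)).2 hsu
    refine (hxs.sum_le_tsum _ fun y _ => hu0 _).trans_eq ?_
    rw [← hu1]
    exact (Equiv.mulLeft x).tsum_eq u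
  have h3 := Finset.card_nsmul_le_sum _ _ _ h1
  rw [← Finset.mul_sum, nsmul_eq_mul] at h3
  rw [← sub_le_iff_le_add, le_div_iff₀ hV]
  linarith

end Energy

section OnDiagonal

variable {S : Finset G}

lemma IsSymmGen.energy_heat_le (hS : IsSymmGen S) (k : ℕ) :
    energy S (heat S k) ≤
      (S.card + 1) ^ 2 * (heat S (2 * k) 1 - heat S (2 * (k + 1)) 1) := by
  have := hS.energy_le (heat_hasFiniteSupport (S := S) k)
  rwa [← heat_succ, hS.tsum_heat_sq, hS.tsum_heat_sq] at this

lemma IsSymmGen.antitone_heat_two_mul (hS : IsSymmGen S) :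
    Antitone fun k => heat S (2 * k) 1 := by
  refine antitone_nat_of_succ_le fun k => ?_
  have h := (energy_nonneg _).trans (hS.energy_heat_le k)
  exact sub_nonneg.1 (nonneg_of_mul_nonneg_right h (by positivity))

lemma heat_zero_one : heat S 0 1 = 1 := by
  simp [heat_zero]

lemma IsSymmGen.heat_two_mul_le_one (hS : IsSymmGen S) (k : ℕ) : heat S (2 * k) 1 ≤ 1 :=
  (hS.antitone_heat_two_mul (Nat.zero_le k)).trans_eq heat_zero_one

/-- The return probabilities at even times are convex. -/
lemma IsSymmGen.heat_two_mul_convex (hS : IsSymmGen S) (k : ℕ) :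
    heat S (2 * (k + 1)) 1 - heat S (2 * (k + 2)) 1 ≤
      heat S (2 * k) 1 - heat S (2 * (k + 1)) 1 := by
  have hs : ∀ i j, Summable fun x => heat S i x * heat S j x := fun i j =>
    summable_of_eq_zero (heat_hasFiniteSupport (S := S) i) (heat_hasFiniteSupport (S := S) i)
      fun x h _ => by simp [h]
  have h1 : 0 ≤ ∑' x, (heat S k x - heat S (k + 2) x) ^ 2 := tsum_nonneg fun _ => sq_nonneg _
  have h2 : ∑' x, (heat S k x - heat S (k + 2) x) ^ 2 =
      heat S (k + k) 1 - 2 * heat S (k + (k + 2)) 1 + heat S (k + 2 + (k + 2)) 1 := by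
    rw [← hS.tsum_heat_mul_heat, ← hS.tsum_heat_mul_heat, ← hS.tsum_heat_mul_heat,
      ← tsum_mul_left, ← Summable.tsum_sub (hs _ _) ((hs _ _).mul_left _),
      ← Summable.tsum_add ((hs _ _).sub ((hs _ _).mul_left _)) (hs _ _)]
    exact tsum_congr fun x => by ring
  rw [show 2 * (k + 1) = k + (k + 2) by ring, show 2 * (k + 2) = k + 2 + (k + 2) by ring,
    two_mul k]
  linarith

lemma IsSymmGen.mul_heat_sub_le (hS : IsSymmGen S) (k j : ℕ) :
    j * (heat S (2 * (k + j)) 1 - heat S (2 * (k + j + 1)) 1) ≤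
      heat S (2 * k) 1 - heat S (2 * (k + j)) 1 := by
  induction j with
  | zero => simp
  | succ j ih =>
    have h := mul_le_mul_of_nonneg_left (hS.heat_two_mul_convex (k + j))
      (show (0 : ℝ) ≤ (j + 1 : ℕ) by positivity)
    rw [show k + (j + 1) = k + j + 1 by ring]
    push_cast at h ⊢
    rw [show k + j + 1 + 1 = k + j + 2 by ring]
    linarith

lemma IsSymmGen.mul_energy_heat_le (hS : IsSymmGen S) (k : ℕ) :
    k * energy S (heat S (4 * k)) ≤ (S.card + 1) ^ 2 * heat S (2 * k) 1 := by
  have h1 := hS.mul_heat_sub_le k (3 * k)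
  have h2 := mul_le_mul_of_nonneg_left (hS.energy_heat_le (4 * k)) (Nat.cast_nonneg (α := ℝ) k)
  rw [show k + 3 * k = 4 * k by ring] at h1
  have h3 := hS.antitone_heat_two_mul (Nat.le_succ (4 * k))
  have h4 := heat_nonneg (S := S) (2 * (4 * k)) 1
  push_cast at h1
  have h5 : (0 : ℝ) ≤ k * (heat S (2 * (4 * k)) 1 - heat S (2 * (4 * k + 1)) 1) :=
    mul_nonneg (Nat.cast_nonneg _) (sub_nonneg.2 h3)
  have h6 : (k : ℝ) * (heat S (2 * (4 * k)) 1 - heat S (2 * (4 * k + 1)) 1) ≤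
      heat S (2 * k) 1 := by linarith
  have h7 := mul_le_mul_of_nonneg_left h6 (show (0 : ℝ) ≤ (S.card + 1) ^ 2 by positivity)
  linarith

/-- The volume of the ball of radius `2 ^ i`. -/
noncomputable def IsSymmGen.vol (hS : IsSymmGen S) (i : ℕ) : ℝ := (hS.ball (2 ^ i)).card

lemma IsSymmGen.vol_pos (hS : IsSymmGen S) (i : ℕ) : 0 < hS.vol i :=
  Nat.cast_pos.2 (hS.card_ball_pos _)

lemma IsSymmGen.vol_mono (hS : IsSymmGen S) : Monotone hS.vol := by
  intro i j hij
  refine Nat.cast_le.2 (Finset.card_le_card fun x hx => ?_)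
  rw [hS.mem_ball] at hx ⊢
  exact hx.trans (Nat.pow_le_pow_right (by norm_num) hij)

lemma IsSymmGen.exists_vol_add_le (hS : IsSymmGen S) (hG : Group.IsNilpotent G) :
    ∃ A : ℝ, 1 ≤ A ∧ ∀ i j, hS.vol (i + j) ≤ A ^ j * hS.vol i := by
  obtain ⟨A, hA⟩ := hS.exists_doubling hG
  refine ⟨A + 1, by simp, fun i j => ?_⟩
  induction j with
  | zero => simp
  | succ j ih =>
    have h1 := hA (2 ^ (i + j)) Nat.one_le_two_pow
    rw [← pow_succ'] at h1
    have h2 : hS.vol (i + (j + 1)) ≤ A * hS.vol (i + j) := by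
      unfold IsSymmGen.vol
      exact_mod_cast h1
    rw [pow_succ', mul_assoc]
    have h3 := mul_le_mul_of_nonneg_left ih (show (0 : ℝ) ≤ A + 1 by positivity)
    have h4 := hS.vol_pos (i + j)
    linarith

/-- The on-diagonal upper bound for the heat kernel. -/
lemma IsSymmGen.exists_heat_mul_vol_le (hS : IsSymmGen S) (hG : Group.IsNilpotent G) :
    ∃ C : ℝ, ∀ i, heat S (2 * 4 ^ i) 1 * hS.vol i ≤ C := by
  obtain ⟨A, hA1, hA⟩ := hS.exists_vol_add_le hG
  obtain ⟨N, hN⟩ : ∃ N : ℝ, N = S.card + 1 := ⟨_, rfl⟩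
  obtain ⟨e, he⟩ := pow_unbounded_of_one_lt (2 * (N ^ 2 * A)) (show (1 : ℝ) < 4 by norm_num)
  have hsmall : ∀ i ≤ e, heat S (2 * 4 ^ i) 1 * hS.vol i ≤ 4 * A ^ (e + 1) + hS.vol e := by
    intro i hi
    have h1 := mul_le_mul (hS.heat_two_mul_le_one (4 ^ i)) (hS.vol_mono hi) (hS.vol_pos i).le
      zero_le_one
    have : 0 < 4 * A ^ (e + 1) := by positivity
    linarith
  refine ⟨4 * A ^ (e + 1) + hS.vol e, fun i => ?_⟩
  induction i with
  | zero => exact hsmall 0 (Nat.zero_le e)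
  | succ i ih =>
    obtain hi | hi := le_total (i + 1) e
    · exact hsmall _ hi
    obtain h | hi := hi.eq_or_lt
    · exact hsmall _ h.ge
    obtain ⟨l, rfl⟩ := Nat.exists_eq_add_of_le' (Nat.lt_succ_iff.1 hi)
    have h1 := hS.tsum_sq_le (heat_hasFiniteSupport (4 * 4 ^ (l + e))) (heat_nonneg _)
      (hS.tsum_heat _) (2 ^ l)
    rw [hS.tsum_heat_sq, ← pow_succ'] at h1
    change _ ≤ 2 / hS.vol l + _ at h1
    have h2 := hS.mul_energy_heat_le (4 ^ (l + e))
    rw [← pow_succ', ← hN] at h2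
    obtain ⟨E, hE⟩ : ∃ E, E = energy S (heat S (4 ^ (l + e + 1))) := ⟨_, rfl⟩
    rw [← hE] at h1 h2
    have h3 : ((2 ^ l : ℕ) : ℝ) ^ 2 = 4 ^ l := by
      push_cast
      rw [← pow_mul, mul_comm, pow_mul]
      norm_num
    rw [h3] at h1
    push_cast at h2
    have hVl := hS.vol_pos l
    have hVi := hS.vol_pos (l + e)
    have hV1 := hA l (e + 1)
    have hV2 := hA (l + e) 1
    rw [pow_one] at hV2
    rw [← add_assoc] at hV1
    have hC : 0 < 4 * A ^ (e + 1) + hS.vol e := by have := hS.vol_pos e; positivity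
    have hfirst : 2 / hS.vol l * hS.vol (l + e + 1) ≤ 2 * A ^ (e + 1) := by
      rw [div_mul_eq_mul_div, div_le_iff₀ hVl]
      linarith
    have hsecond : 4 ^ l * E * hS.vol (l + e + 1) ≤ (4 * A ^ (e + 1) + hS.vol e) / 2 := by
      have hE0 : 0 ≤ E := hE ▸ energy_nonneg _
      refine le_of_mul_le_mul_left ?_ (show (0 : ℝ) < 4 ^ e by positivity)
      calc (4 : ℝ) ^ e * (4 ^ l * E * hS.vol (l + e + 1))
          = 4 ^ (l + e) * E * hS.vol (l + e + 1) := by ring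
        _ ≤ N ^ 2 * heat S (2 * 4 ^ (l + e)) 1 * (A * hS.vol (l + e)) :=
          mul_le_mul h2 hV2 (hS.vol_pos _).le (mul_nonneg (sq_nonneg N) (heat_nonneg _ _))
        _ = N ^ 2 * A * (heat S (2 * 4 ^ (l + e)) 1 * hS.vol (l + e)) := by ring
        _ ≤ N ^ 2 * A * (4 * A ^ (e + 1) + hS.vol e) := by gcongr
        _ ≤ 4 ^ e * ((4 * A ^ (e + 1) + hS.vol e) / 2) := by nlinarith
    have h4 := mul_le_mul_of_nonneg_right h1 (hS.vol_pos (l + e + 1)).le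
    rw [add_mul] at h4
    have h5 := hS.vol_pos e
    linarith

end OnDiagonal

section OffDiagonal

variable {S : Finset G}

/-- The `ℓ²` norm squared of the heat kernel at time `k` with an exponential weight
at scale `R`. -/
noncomputable def weightedSq (S : Finset G) (R : ℝ) (k : ℕ) : ℝ :=
  ∑' x, Real.exp (wordLength S x / R) * heat S k x ^ 2

lemma weightedSq_nonneg (R : ℝ) (k : ℕ) : 0 ≤ weightedSq S R k :=
  tsum_nonneg fun _ => by positivity

lemma abs_exp_sub_exp_le {R a b : ℝ} (hR : 1 ≤ R) (hab : |b - a| ≤ 1) :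
    |Real.exp (b / R) - Real.exp (a / R)| ≤ 2 / R * Real.exp (a / R) := by
  have hR0 : 0 < R := by linarith
  have h1 : |(b - a) / R| ≤ 1 / R := by
    rw [abs_div, abs_of_pos hR0]
    gcongr
  have h2 : |Real.exp ((b - a) / R) - 1| ≤ 2 * |(b - a) / R| :=
    Real.abs_exp_sub_one_le (h1.trans (by rw [div_le_one hR0]; exact hR))
  have h3 : Real.exp (b / R) - Real.exp (a / R) =
      (Real.exp ((b - a) / R) - 1) * Real.exp (a / R) := by
    rw [sub_mul, ← Real.exp_add, one_mul, ← add_div, sub_add_cancel]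
  rw [h3, abs_mul, Real.abs_exp]
  gcongr
  refine h2.trans ((mul_le_mul_of_nonneg_left h1 zero_le_two).trans_eq ?_)
  ring

lemma IsSymmGen.abs_wordLength_mul_sub_le (hS : IsSymmGen S) (x : G)
    (a : Option {x // x ∈ S}) :
    |(wordLength S (x * lazyVal a) : ℝ) - wordLength S x| ≤ 1 := by
  have h0 : wordLength S (lazyVal a) ≤ 1 := by
    cases a with
    | none => simp [lazyVal]
    | some s => exact wordLength_le_one s.2
  have h1 := hS.wordLength_mul_le x (lazyVal a)
  have h2 := hS.wordLength_mul_le (x * lazyVal a) (lazyVal a)⁻¹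
  have h3 := hS.wordLength_inv_le (lazyVal a)
  rw [mul_inv_cancel_right] at h2
  have h4 : wordLength S (x * lazyVal a) ≤ wordLength S x + 1 := by omega
  have h5 : wordLength S x ≤ wordLength S (x * lazyVal a) + 1 := by omega
  rw [abs_sub_le_iff]
  constructor
  · rw [sub_le_iff_le_add']
    exact_mod_cast h4
  · rw [sub_le_iff_le_add']
    exact_mod_cast h5

lemma IsSymmGen.weightedSq_add_le (hS : IsSymmGen S) {R : ℝ} (hR : 1 ≤ R) (k j : ℕ) :
    weightedSq S R (k + j) ≤ Real.exp ((S.card + 1) * j / R ^ 2) * weightedSq S R k := by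
  induction j with
  | zero => simp
  | succ j ih =>
    have h := hS.weighted_lazyStep_le (heat_hasFiniteSupport (S := S) (k + j))
      (W := fun x => Real.exp (wordLength S x / R)) (fun x => Real.exp_pos _) (η := 2 / R)
      (fun x a => ⟨abs_exp_sub_exp_le hR (hS.abs_wordLength_mul_sub_le x a), by
        rw [abs_sub_comm]
        refine abs_exp_sub_exp_le hR ?_
        rw [abs_sub_comm]
        exact hS.abs_wordLength_mul_sub_le x a⟩)
    rw [← heat_succ] at h
    change weightedSq S R (k + j + 1) ≤ _ * weightedSq S R (k + j) at h
    have h1 : 1 + (S.card + 1) * (2 / R) ^ 2 / 4 ≤ Real.exp ((S.card + 1) / R ^ 2) := by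
      refine le_trans (le_of_eq ?_) (Real.add_one_le_exp _)
      ring
    calc weightedSq S R (k + j + 1)
        ≤ Real.exp ((S.card + 1) / R ^ 2) *
          (Real.exp ((S.card + 1) * j / R ^ 2) * weightedSq S R k) := by
          refine h.trans (mul_le_mul h1 ih (weightedSq_nonneg _ _) (Real.exp_nonneg _))
      _ = _ := by
          rw [← mul_assoc, ← Real.exp_add]
          congr 2
          push_cast
          ring

lemma IsSymmGen.weightedSq_two_mul_sq_le (hS : IsSymmGen S) (R : ℝ) (k : ℕ) :
    weightedSq S (2 * R) k ^ 2 ≤ heat S (2 * k) 1 * weightedSq S R k := by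
  have hk := heat_hasFiniteSupport (S := S) k
  have h := tsum_mul_sq_le (g := fun x => Real.exp (wordLength S x / (2 * R)) * heat S k x) hk
  rw [hS.tsum_heat_sq] at h
  have h1 : weightedSq S (2 * R) k =
      ∑' x, heat S k x * (Real.exp (wordLength S x / (2 * R)) * heat S k x) :=
    tsum_congr fun x => by ring
  rw [h1]
  refine h.trans (mul_le_mul_of_nonneg_left ?_ (heat_nonneg _ _))
  have h2 : ∀ x, (Real.exp (wordLength S x / (2 * R)) * heat S k x) ^ 2 =
      Real.exp (wordLength S x / R) * heat S k x ^ 2 := fun x => by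
    rw [mul_pow, ← Real.exp_nat_mul]
    congr 2
    push_cast
    ring
  simp only [h2]
  exact Summable.sum_le_tsum _ (fun x _ => by positivity)
    (summable_of_eq_zero hk hk fun x h _ => by simp [h])

/-- The heat kernel satisfies a Gaussian-type off-diagonal bound in the `ℓ²` sense. -/
lemma IsSymmGen.exists_weightedSq_mul_vol_le (hS : IsSymmGen S) (hG : Group.IsNilpotent G) :
    ∃ C : ℝ, ∀ i k, 4 ^ i ≤ k → k ≤ 4 ^ (i + 1) → weightedSq S (2 ^ i) k * hS.vol i ≤ C := by
  obtain ⟨A, hA1, hA⟩ := hS.exists_vol_add_le hG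
  obtain ⟨C, hC⟩ := hS.exists_heat_mul_vol_le hG
  obtain ⟨N, hN⟩ : ∃ N : ℝ, N = S.card + 1 := ⟨_, rfl⟩
  have hN0 : 0 < N := by rw [hN]; positivity
  have hR : ∀ i : ℕ, (1 : ℝ) ≤ 2 ^ i := fun i => one_le_pow₀ one_le_two
  have hR2 : ∀ i : ℕ, ((2 : ℝ) ^ i) ^ 2 = 4 ^ i := fun i => by
    rw [← pow_mul, mul_comm, pow_mul]
    norm_num
  have hC0 : 0 ≤ C := (mul_nonneg (heat_nonneg _ _) (hS.vol_pos 0).le).trans (hC 0)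
  obtain ⟨D, hD⟩ : ∃ D, D = max (weightedSq S (2 ^ 0) (4 ^ 0) * hS.vol 0)
    (Real.exp N ^ 2 * A ^ 2 * C) := ⟨_, rfl⟩
  have hD0 : 0 ≤ D := hD ▸ le_max_of_le_right (by positivity)
  have main : ∀ i, weightedSq S (2 ^ i) (4 ^ i) * hS.vol i ≤ D := by
    intro i
    induction i with
    | zero => exact hD ▸ le_max_left _ _
    | succ i ih =>
      have h1 := hS.weightedSq_add_le (hR (i + 1)) (4 ^ i) (3 * 4 ^ i)
      rw [show 4 ^ i + 3 * 4 ^ i = 4 ^ (i + 1) by ring, hR2, ← hN] at h1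
      have h2 : Real.exp (N * ((3 * 4 ^ i : ℕ) : ℝ) / 4 ^ (i + 1)) ≤ Real.exp N := by
        rw [Real.exp_le_exp, div_le_iff₀ (by positivity)]
        refine mul_le_mul_of_nonneg_left ?_ hN0.le
        push_cast
        rw [pow_succ']
        have : (0 : ℝ) < 4 ^ i := by positivity
        linarith
      have h3 := hS.weightedSq_two_mul_sq_le (2 ^ i) (4 ^ i)
      rw [← pow_succ'] at h3
      have h4 : weightedSq S (2 ^ (i + 1)) (4 ^ (i + 1)) ≤
          Real.exp N * weightedSq S (2 ^ (i + 1)) (4 ^ i) :=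
        h1.trans (mul_le_mul_of_nonneg_right h2 (weightedSq_nonneg _ _))
      have h5 := hA i 1
      rw [pow_one] at h5
      have h6 := hS.vol_pos i
      have h7 := hS.vol_pos (i + 1)
      have h8 := weightedSq_nonneg (S := S) (2 ^ i) (4 ^ i)
      have h9 := weightedSq_nonneg (S := S) (2 ^ (i + 1)) (4 ^ (i + 1))
      have h10 := heat_nonneg (S := S) (2 * 4 ^ i) 1
      have h11 := h9.trans h4
      refine le_of_sq_le_sq ?_ hD0
      calc (weightedSq S (2 ^ (i + 1)) (4 ^ (i + 1)) * hS.vol (i + 1)) ^ 2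
          ≤ (Real.exp N * weightedSq S (2 ^ (i + 1)) (4 ^ i) * (A * hS.vol i)) ^ 2 := by gcongr
        _ = Real.exp N ^ 2 * A ^ 2 * hS.vol i ^ 2 * weightedSq S (2 ^ (i + 1)) (4 ^ i) ^ 2 := by
          ring
        _ ≤ Real.exp N ^ 2 * A ^ 2 * hS.vol i ^ 2 *
            (heat S (2 * 4 ^ i) 1 * weightedSq S (2 ^ i) (4 ^ i)) := by gcongr
        _ = Real.exp N ^ 2 * A ^ 2 * (heat S (2 * 4 ^ i) 1 * hS.vol i) *
            (weightedSq S (2 ^ i) (4 ^ i) * hS.vol i) := by ring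
        _ ≤ Real.exp N ^ 2 * A ^ 2 * C * D := by
          gcongr
          exact hC i
        _ ≤ D * D := by
          gcongr
          exact hD ▸ le_max_right _ _
        _ = D ^ 2 := by ring
  refine ⟨Real.exp (4 * N) * D, fun i k hk1 hk2 => ?_⟩
  obtain ⟨j, rfl⟩ := Nat.exists_eq_add_of_le hk1
  have h1 := hS.weightedSq_add_le (hR i) (4 ^ i) j
  rw [hR2, ← hN] at h1
  have hj : (j : ℝ) ≤ 4 * 4 ^ i := by
    have : j ≤ 4 * 4 ^ i := by rw [← pow_succ']; omega
    exact_mod_cast this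
  have h2 : Real.exp (N * j / 4 ^ i) ≤ Real.exp (4 * N) := by
    rw [Real.exp_le_exp, div_le_iff₀ (by positivity)]
    nlinarith
  calc weightedSq S (2 ^ i) (4 ^ i + j) * hS.vol i
      ≤ Real.exp (4 * N) * weightedSq S (2 ^ i) (4 ^ i) * hS.vol i := by
        refine mul_le_mul_of_nonneg_right (h1.trans ?_) (hS.vol_pos i).le
        exact mul_le_mul_of_nonneg_right h2 (weightedSq_nonneg _ _)
    _ ≤ Real.exp (4 * N) * D := by
        rw [mul_assoc]
        exact mul_le_mul_of_nonneg_left (main i) (Real.exp_nonneg _)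

end OffDiagonal

section Moments

variable {S : Finset G}

lemma exists_pow_mul_exp_neg_le (A : ℝ) (hA : 1 ≤ A) :
    ∃ c : ℝ, 1 ≤ c ∧ ∀ J : ℕ, A ^ (J + 1) * Real.exp (-(2 ^ J / 2)) ≤ c / 2 ^ (J + 1) := by
  obtain ⟨s, hs⟩ := pow_unbounded_of_one_lt (2 * A) one_lt_two
  refine ⟨4 ^ s * s.factorial, ?_, fun J => ?_⟩
  · have h1 : (1 : ℝ) ≤ s.factorial := by exact_mod_cast s.factorial_pos
    exact one_le_mul_of_one_le_of_one_le (one_le_pow₀ (by norm_num)) h1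
  · have h1 := Real.pow_div_factorial_le_exp (x := 2 ^ J / 2) (by positivity) s
    rw [div_le_iff₀ (by positivity)] at h1
    rw [le_div_iff₀ (by positivity), Real.exp_neg, mul_right_comm, ← div_eq_mul_inv,
      div_le_iff₀ (Real.exp_pos _), ← mul_pow]
    calc (A * 2) ^ (J + 1) ≤ (2 ^ s) ^ (J + 1) := by gcongr; linarith
      _ = 4 ^ s * (2 ^ J / 2) ^ s := by
        rw [div_pow, show (4 : ℝ) = 2 * 2 by norm_num, mul_pow, ← pow_mul, ← pow_mul]
        field_simp
        ring
      _ ≤ 4 ^ s * (Real.exp (2 ^ J / 2) * s.factorial) := by gcongr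
      _ = _ := by ring

/-- Exponential decay at scale `2 ^ i` is summable, with sum comparable to the volume. -/
lemma IsSymmGen.exists_sum_exp_neg_le (hS : IsSymmGen S) (hG : Group.IsNilpotent G) :
    ∃ C : ℝ, ∀ i, ∀ F : Finset G,
      ∑ x ∈ F, Real.exp (-(wordLength S x / (2 * 2 ^ i))) ≤ C * hS.vol i := by
  classical
  obtain ⟨A, hA1, hA⟩ := hS.exists_vol_add_le hG
  obtain ⟨c, hc1, hc⟩ := exists_pow_mul_exp_neg_le A hA1
  have hball : ∀ i J, ∑ x ∈ hS.ball (2 ^ (i + J)), Real.exp (-(wordLength S x / (2 * 2 ^ i))) ≤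
      c * hS.vol i * (2 - 1 / 2 ^ J) := by
    intro i J
    have hV := hS.vol_pos i
    induction J with
    | zero =>
      have h1 : ∑ x ∈ hS.ball (2 ^ (i + 0)), Real.exp (-(wordLength S x / (2 * 2 ^ i))) ≤
          hS.vol i := by
        rw [add_zero]
        refine (Finset.sum_le_card_nsmul _ _ 1 fun x _ => ?_).trans_eq ?_
        · rw [Real.exp_le_one_iff, neg_nonpos]
          positivity
        · simp [IsSymmGen.vol]
      norm_num
      rw [add_zero] at h1
      nlinarith
    | succ J ih =>
      have hsub : hS.ball (2 ^ (i + J)) ⊆ hS.ball (2 ^ (i + (J + 1))) := fun x hx => by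
        rw [hS.mem_ball] at hx ⊢
        exact hx.trans (Nat.pow_le_pow_right (by norm_num) (by omega))
      rw [← Finset.sum_sdiff hsub]
      have h1 : ∑ x ∈ hS.ball (2 ^ (i + (J + 1))) \ hS.ball (2 ^ (i + J)),
          Real.exp (-(wordLength S x / (2 * 2 ^ i))) ≤
          A ^ (J + 1) * hS.vol i * Real.exp (-(2 ^ J / 2)) := by
        refine (Finset.sum_le_card_nsmul _ _ (Real.exp (-(2 ^ J / 2))) fun x hx => ?_).trans ?_
        · rw [Finset.mem_sdiff, hS.mem_ball, hS.mem_ball, not_le] at hx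
          have h2 : (2 : ℝ) ^ (i + J) ≤ wordLength S x := by exact_mod_cast hx.2.le
          rw [Real.exp_le_exp, neg_le_neg_iff, div_le_div_iff₀ (by norm_num) (by positivity)]
          rw [pow_add] at h2
          linarith
        · rw [nsmul_eq_mul]
          refine mul_le_mul_of_nonneg_right (le_trans ?_ (hA i (J + 1))) (Real.exp_nonneg _)
          exact Nat.cast_le.2 (Finset.card_le_card Finset.sdiff_subset)
      have h2 := mul_le_mul_of_nonneg_right (hc J) hV.le
      have h3 : c * hS.vol i * (2 - 1 / 2 ^ (J + 1)) =
          c / 2 ^ (J + 1) * hS.vol i + c * hS.vol i * (2 - 1 / 2 ^ J) := by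
        field_simp
        ring
      rw [h3]
      linarith
  refine ⟨c * 2, fun i F => ?_⟩
  have hF : F ⊆ hS.ball (2 ^ (i + F.sup (wordLength S))) := fun x hx => by
    rw [hS.mem_ball]
    refine (Finset.le_sup (f := wordLength S) hx).trans (Nat.lt_two_pow_self.le.trans ?_)
    exact Nat.pow_le_pow_right (by norm_num) (by omega)
  refine (Finset.sum_le_sum_of_subset_of_nonneg hF fun _ _ _ => Real.exp_nonneg _).trans
    ((hball i _).trans ?_)
  have h1 : (0 : ℝ) < 1 / 2 ^ F.sup (wordLength S) := by positivity
  have h2 := mul_pos (mul_pos (by linarith : 0 < c) (hS.vol_pos i)) h1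
  linarith

/-- Exponential moments of the lazy random walk at its diffusive scale. -/
lemma IsSymmGen.exists_expMoment_le (hS : IsSymmGen S) (hG : Group.IsNilpotent G) :
    ∃ C : ℝ, ∀ i k, 4 ^ i ≤ k → k ≤ 4 ^ (i + 1) →
      ∑' x, Real.exp (wordLength S x / (4 * 2 ^ i)) * heat S k x ≤ C := by
  obtain ⟨C, hC⟩ := hS.exists_weightedSq_mul_vol_le hG
  obtain ⟨D, hD⟩ := hS.exists_sum_exp_neg_le hG
  have hC0 : 0 ≤ C := (mul_nonneg (weightedSq_nonneg _ _) (hS.vol_pos 0).le).trans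
    (hC 0 1 (by simp) (by simp))
  have hD0 : 0 ≤ D := nonneg_of_mul_nonneg_left (by simpa using hD 0 ∅) (hS.vol_pos 0)
  refine ⟨Real.sqrt (C * D), fun i k hk1 hk2 => Real.le_sqrt_of_sq_le ?_⟩
  have hk : (fun x => Real.exp (wordLength S x / (2 * 2 ^ i)) * heat S k x).HasFiniteSupport :=
    (heat_hasFiniteSupport (S := S) k).subset (Function.support_mul_subset_right _ _)
  have h := tsum_mul_sq_le (g := fun x => Real.exp (-(wordLength S x / (4 * 2 ^ i)))) hk
  have e1 : ∑' x, Real.exp (wordLength S x / (4 * 2 ^ i)) * heat S k x =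
      ∑' x, Real.exp (wordLength S x / (2 * 2 ^ i)) * heat S k x *
        Real.exp (-(wordLength S x / (4 * 2 ^ i))) := by
    refine tsum_congr fun x => ?_
    rw [mul_right_comm, ← Real.exp_add]
    congr 2
    field_simp
    ring
  have e2 : ∑' x, (Real.exp (wordLength S x / (2 * 2 ^ i)) * heat S k x) ^ 2 =
      weightedSq S (2 ^ i) k := by
    refine tsum_congr fun x => ?_
    rw [mul_pow, ← Real.exp_nat_mul]
    congr 2
    push_cast
    field_simp
  have e3 : ∀ x, Real.exp (-(wordLength S x / (4 * 2 ^ i))) ^ 2 =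
      Real.exp (-(wordLength S x / (2 * 2 ^ i))) := fun x => by
    rw [← Real.exp_nat_mul]
    congr 1
    push_cast
    field_simp
    ring
  simp only [e3] at h
  rw [e1]
  refine h.trans ?_
  rw [e2]
  refine (mul_le_mul_of_nonneg_left (hD i _) (weightedSq_nonneg _ _)).trans ?_
  have := mul_le_mul_of_nonneg_right (hC i k hk1 hk2) hD0
  linarith

/-- Moments of the lazy random walk are at most diffusive. -/
lemma IsSymmGen.exists_moment_le (hS : IsSymmGen S) (hG : Group.IsNilpotent G) (m : ℕ) :
    ∃ C : ℝ, 0 ≤ C ∧ ∀ i k, 4 ^ i ≤ k → k ≤ 4 ^ (i + 1) →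
      ∑' x, (wordLength S x : ℝ) ^ m * heat S k x ≤ C * (2 ^ i) ^ m := by
  obtain ⟨C, hC⟩ := hS.exists_expMoment_le hG
  have hC0 : 0 ≤ C := (tsum_nonneg fun x => mul_nonneg (Real.exp_nonneg _)
    (heat_nonneg _ _)).trans (hC 0 1 (by simp) (by simp))
  refine ⟨m.factorial * 4 ^ m * C, by positivity, fun i k hk1 hk2 => ?_⟩
  have hk := heat_hasFiniteSupport (S := S) k
  calc ∑' x, (wordLength S x : ℝ) ^ m * heat S k x
      ≤ ∑' x, m.factorial * (4 * 2 ^ i) ^ m *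
          (Real.exp (wordLength S x / (4 * 2 ^ i)) * heat S k x) := by
        refine Summable.tsum_le_tsum (fun x => ?_) (summable_of_eq_zero hk hk fun x h _ => by
          simp [h]) (summable_of_eq_zero hk hk fun x h _ => by simp [h])
        rw [← mul_assoc]
        refine mul_le_mul_of_nonneg_right ?_ (heat_nonneg _ _)
        have h1 := Real.pow_div_factorial_le_exp
          (x := wordLength S x / (4 * 2 ^ i)) (by positivity) m
        rw [div_le_iff₀ (by positivity), div_pow, div_le_iff₀ (by positivity)] at h1
        linarith
    _ ≤ m.factorial * (4 * 2 ^ i) ^ m * C := by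
        rw [tsum_mul_left]
        exact mul_le_mul_of_nonneg_left (hC i k hk1 hk2) (by positivity)
    _ = _ := by ring

/-- The on-diagonal lower bound for the heat kernel. -/
lemma IsSymmGen.exists_le_heat_mul_vol (hS : IsSymmGen S) (hG : Group.IsNilpotent G) :
    ∃ c : ℝ, 0 < c ∧ ∀ i, c ≤ heat S (2 * 4 ^ i) 1 * hS.vol i := by
  obtain ⟨A, hA1, hA⟩ := hS.exists_vol_add_le hG
  obtain ⟨C, hC0, hC⟩ := hS.exists_moment_le hG 1
  obtain ⟨e, he⟩ := pow_unbounded_of_one_lt (2 * C) one_lt_two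
  have hA0 : 0 < A := by linarith
  refine ⟨1 / (4 * A ^ e), by positivity, fun i => ?_⟩
  obtain ⟨k, hk⟩ : ∃ k, k = 4 ^ i := ⟨_, rfl⟩
  have hm := hC i k hk.ge (hk.le.trans (Nat.pow_le_pow_right (by norm_num) (by omega)))
  simp only [pow_one] at hm
  rw [← hk]
  have hs := heat_hasFiniteSupport (S := S) k
  obtain ⟨B, hB⟩ : ∃ B, B = hS.ball (2 ^ (i + e)) := ⟨_, rfl⟩
  have hR : (0 : ℝ) < 2 ^ (i + e) := by positivity
  have hmass : 1 / 2 ≤ ∑ x ∈ B, heat S k x := by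
    have h1 : ∑' x, heat S k x ≤
        ∑' x, ((B : Set G).indicator (heat S k) x +
          (2 ^ (i + e))⁻¹ * (wordLength S x * heat S k x)) := by
      refine Summable.tsum_le_tsum (fun x => ?_) (summable_of_eq_zero hs hs fun x h _ => h)
        (summable_of_eq_zero hs hs fun x h _ => by simp [Set.indicator, h])
      have h0 := heat_nonneg (S := S) k x
      by_cases hx : x ∈ B
      · rw [Set.indicator_of_mem (Finset.mem_coe.2 hx)]
        have : 0 ≤ (2 ^ (i + e))⁻¹ * (wordLength S x * heat S k x) := by positivity
        linarith
      · rw [Set.indicator_of_notMem (by simpa using hx), zero_add, ← mul_assoc]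
        refine le_mul_of_one_le_left h0 ?_
        rw [← div_eq_inv_mul, one_le_div hR]
        rw [hB, hS.mem_ball, not_le] at hx
        exact_mod_cast hx.le
    rw [hS.tsum_heat, Summable.tsum_add
      (summable_of_eq_zero hs hs fun x h _ => by simp [Set.indicator, h])
      (summable_of_eq_zero hs hs fun x h _ => by simp [h]), tsum_mul_left,
      ← sum_eq_tsum_indicator] at h1
    have h2 : (2 ^ (i + e) : ℝ)⁻¹ * ∑' x, wordLength S x * heat S k x ≤ 1 / 2 := by
      rw [← div_eq_inv_mul, div_le_iff₀ hR, pow_add]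
      have h3 : (0 : ℝ) < 2 ^ i := by positivity
      nlinarith
    linarith
  have hcs := sq_sum_le_card_mul_sum_sq (s := B) (f := heat S k)
  have hq : ∑ x ∈ B, heat S k x ^ 2 ≤ heat S (2 * k) 1 := by
    rw [← hS.tsum_heat_sq]
    exact Summable.sum_le_tsum _ (fun _ _ => sq_nonneg _)
      (summable_of_eq_zero hs hs fun x h _ => by simp [h])
  have hV : (B.card : ℝ) ≤ A ^ e * hS.vol i := hB ▸ hA i e
  have h4 : (1 / 2 : ℝ) ^ 2 ≤ A ^ e * hS.vol i * heat S (2 * k) 1 := by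
    calc (1 / 2 : ℝ) ^ 2 ≤ (∑ x ∈ B, heat S k x) ^ 2 := by gcongr
      _ ≤ _ := hcs
      _ ≤ _ := mul_le_mul hV hq (Finset.sum_nonneg fun _ _ => sq_nonneg _)
        (mul_nonneg (by positivity) (hS.vol_pos i).le)
  rw [div_le_iff₀ (by positivity)]
  linarith

/-- Return probabilities at comparable times are comparable. -/
lemma IsSymmGen.exists_heat_le_heat (hS : IsSymmGen S) (hG : Group.IsNilpotent G) :
    ∃ C : ℝ, 0 ≤ C ∧ ∀ K N, N ≤ 2 * K + 1 → heat S (2 * K) 1 ≤ C * heat S (2 * N) 1 := by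
  obtain ⟨A, hA1, hA⟩ := hS.exists_vol_add_le hG
  obtain ⟨C, hC⟩ := hS.exists_heat_mul_vol_le hG
  obtain ⟨c, hc0, hc⟩ := hS.exists_le_heat_mul_vol hG
  have hC0 : 0 < C := hc0.trans_le ((hc 0).trans (hC 0))
  have key : ∀ i, heat S (2 * 4 ^ i) 1 ≤ C * A ^ 2 / c * heat S (2 * 4 ^ (i + 2)) 1 := by
    intro i
    have h1 := hC i
    have h2 := hc (i + 2)
    have h3 := hA i 2
    have h4 := hS.vol_pos i
    have h5 := heat_nonneg (S := S) (2 * 4 ^ (i + 2)) 1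
    rw [div_mul_eq_mul_div, le_div_iff₀ hc0]
    refine le_of_mul_le_mul_right ?_ h4
    calc heat S (2 * 4 ^ i) 1 * c * hS.vol i = heat S (2 * 4 ^ i) 1 * hS.vol i * c := by ring
      _ ≤ C * (heat S (2 * 4 ^ (i + 2)) 1 * (A ^ 2 * hS.vol i)) := by
        refine mul_le_mul h1 (h2.trans ?_) hc0.le hC0.le
        gcongr
      _ = _ := by ring
  have hq : 0 < heat S (2 * 1) 1 := by
    have h1 := hc 0
    rw [pow_zero] at h1
    exact pos_of_mul_pos_left (hc0.trans_le h1) (hS.vol_pos 0).le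
  refine ⟨max (C * A ^ 2 / c) (heat S (2 * 1) 1)⁻¹, le_max_of_le_right (by positivity),
    fun K N hN => ?_⟩
  obtain rfl | hK := Nat.eq_zero_or_pos K
  · have h1 := hS.antitone_heat_two_mul hN
    simp only [mul_zero, zero_add] at h1
    rw [mul_zero, heat_zero_one]
    calc (1 : ℝ) = (heat S (2 * 1) 1)⁻¹ * heat S (2 * 1) 1 := (inv_mul_cancel₀ hq.ne').symm
      _ ≤ _ := mul_le_mul (le_max_right _ _) h1 hq.le (le_max_of_le_right (by positivity))
  · have h1 := Nat.pow_log_le_self 4 hK.ne'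
    have h2 := Nat.lt_pow_succ_log_self (b := 4) (by norm_num) K
    obtain ⟨i, hi⟩ : ∃ i, i = Nat.log 4 K := ⟨_, rfl⟩
    rw [← hi] at h1 h2
    have h3 : N ≤ 4 ^ (i + 2) := by
      rw [pow_succ]
      omega
    calc heat S (2 * K) 1 ≤ heat S (2 * 4 ^ i) 1 := hS.antitone_heat_two_mul h1
      _ ≤ _ := key i
      _ ≤ _ := mul_le_mul (le_max_left _ _) (hS.antitone_heat_two_mul h3) (heat_nonneg _ _)
        (le_max_of_le_right (by positivity))

end Moments

section Words

variable {S : Finset G}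

lemma sum_words (k : ℕ) (f : G → ℝ) (x : G) :
    ∑ w : Fin k → Option {x // x ∈ S}, f (x * ((List.ofFn w).map lazyVal).prod) =
      (S.card + 1) ^ k * (lazyStep S)^[k] f x := by
  induction k generalizing x with
  | zero => simp
  | succ k ih =>
    rw [Function.iterate_succ_apply', lazyStep, pow_succ, mul_assoc,
      mul_div_cancel₀ _ (Nat.cast_add_one_ne_zero S.card), Finset.mul_sum,
      ← (Fin.consEquiv fun _ => Option {x // x ∈ S}).sum_comp, Fintype.sum_prod_type]
    refine Finset.sum_congr rfl fun a _ => ?_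
    rw [← ih]
    refine Finset.sum_congr rfl fun w _ => ?_
    simp [Fin.consEquiv, mul_assoc]

lemma walkPos_append {t s : ℕ} (u : Fin t → Option {x // x ∈ S})
    (v : Fin s → Option {x // x ∈ S}) :
    walkPos (Fin.append u v) t = ((List.ofFn u).map lazyVal).prod := by
  rw [walkPos, List.ofFn_fin_append, List.take_left' (by simp)]

lemma walkPos_append_add {t s : ℕ} (u : Fin t → Option {x // x ∈ S})
    (v : Fin s → Option {x // x ∈ S}) :
    walkPos (Fin.append u v) (t + s) =
      ((List.ofFn u).map lazyVal).prod * ((List.ofFn v).map lazyVal).prod := by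
  rw [walkPos, List.take_of_length_le (by simp), List.ofFn_fin_append, List.map_append,
    List.prod_append]

/-- Averages over closed words are computed by the heat kernel. -/
lemma IsSymmGen.sum_closedWalks (hS : IsSymmGen S) (t s : ℕ) (f : G → ℝ) :
    ∑ w ∈ closedWalks S (t + s), f (walkPos w t) =
      (S.card + 1) ^ (t + s) * ∑' x, heat S t x * (f x * heat S s x) := by
  classical
  rw [closedWalks, Finset.sum_filter, ← (Fin.appendEquiv t s).sum_comp, Fintype.sum_prod_type,
    hS.tsum_heat_mul t fun x => f x * heat S s x, pow_add, mul_right_comm, ← sum_words,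
    Finset.sum_mul]
  refine Finset.sum_congr rfl fun u _ => ?_
  rw [one_mul, mul_assoc, mul_comm (heat S s _), heat, ← sum_words, Finset.mul_sum]
  refine Finset.sum_congr rfl fun v _ => ?_
  simp only [Fin.appendEquiv, Equiv.coe_fn_mk, walkPos_append, walkPos_append_add]
  split_ifs with h
  · rw [h, Set.indicator_of_mem (Set.mem_singleton _), Pi.one_apply, mul_one]
  · rw [Set.indicator_of_notMem (mt Set.mem_singleton_iff.1 h), mul_zero]

lemma IsSymmGen.card_closedWalks (hS : IsSymmGen S) (n : ℕ) :
    ((closedWalks S n).card : ℝ) = (S.card + 1) ^ n * heat S n 1 := by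
  have h := hS.sum_closedWalks n 0 fun _ => 1
  simp only [one_mul, hS.tsum_heat_mul_heat] at h
  simpa using h

lemma IsSymmGen.exists_heat_le (hS : IsSymmGen S) (hG : Group.IsNilpotent G) :
    ∃ C : ℝ, 0 ≤ C ∧ ∀ k n, n ≤ 2 * k → ∀ g, heat S k g ≤ C * heat S n 1 := by
  obtain ⟨C, hC0, hC⟩ := hS.exists_heat_le_heat hG
  refine ⟨C * (S.card + 1), by positivity, fun k n hkn g => (hS.heat_le k g).trans ?_⟩
  refine (hC (k / 2) (n / 2) (by omega)).trans ?_
  rw [mul_assoc]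
  exact mul_le_mul_of_nonneg_left (heat_two_mul_half_le n) hC0

lemma IsSymmGen.exists_moment_le_sqrt (hS : IsSymmGen S) (hG : Group.IsNilpotent G) {m : ℕ}
    (hm : 1 ≤ m) : ∃ C : ℝ, 0 ≤ C ∧ ∀ k : ℕ,
      ∑' x, heat S k x * (wordLength S x : ℝ) ^ m ≤ C * √k ^ m := by
  obtain ⟨C, hC0, hC⟩ := hS.exists_moment_le hG m
  refine ⟨C, hC0, fun k => ?_⟩
  obtain rfl | hk := Nat.eq_zero_or_pos k
  · rw [hS.tsum_heat_mul 0 fun x => (wordLength S x : ℝ) ^ m]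
    simp [show m ≠ 0 by omega]
  · have h1 := Nat.pow_log_le_self 4 hk.ne'
    have h2 := Nat.lt_pow_succ_log_self (b := 4) (by norm_num) k
    simp only [mul_comm (heat S k _)]
    refine (hC _ k h1 h2.le).trans ?_
    gcongr
    refine Real.le_sqrt_of_sq_le ?_
    rw [← pow_mul, mul_comm, pow_mul]
    norm_num
    exact_mod_cast h1

end Words

theorem moment_upper_bound (G : Type*) [Group G] (S : Finset G)
    (hgen : Subgroup.closure (S : Set G) = ⊤)
    (hsymm : ∀ x ∈ S, x⁻¹ ∈ S)
    (hnilp : Group.IsNilpotent G)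
    (m : ℕ) (hm : 1 ≤ m) :
    ∃ c : ℝ, ∀ n : ℕ, 0 < n → ∀ t : ℕ, t ≤ n →
      (∑ w ∈ closedWalks S n, ((wordLength S (walkPos w t) : ℝ)) ^ m) /
          ((closedWalks S n).card : ℝ)
        ≤ c * (t : ℝ) ^ ((m : ℝ) / 2) := by
  have hS : IsSymmGen S := ⟨hgen, hsymm⟩
  obtain ⟨C, hC0, hC⟩ := hS.exists_moment_le_sqrt hnilp hm
  obtain ⟨D, hD0, hD⟩ := hS.exists_heat_le hnilp
  refine ⟨D * C, fun n _ t htn => ?_⟩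
  obtain ⟨s, rfl⟩ := Nat.exists_eq_add_of_le htn
  have hsqrt : (t : ℝ) ^ ((m : ℝ) / 2) = √t ^ m := by
    rw [Real.sqrt_eq_rpow, ← Real.rpow_natCast, ← Real.rpow_mul (Nat.cast_nonneg t)]
    congr 1
    ring
  rw [hsqrt, hS.sum_closedWalks t s fun x => (wordLength S x : ℝ) ^ m, hS.card_closedWalks,
    mul_div_mul_left _ _ (by positivity)]
  have hn := heat_nonneg (S := S) (t + s) 1
  refine div_le_of_le_mul₀ hn (by positivity) ?_
  have bound : ∀ k l, k ≤ t → t + s ≤ 2 * l →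
      ∑' x, heat S k x * (wordLength S x : ℝ) ^ m * heat S l x ≤
        D * C * √t ^ m * heat S (t + s) 1 := by
    intro k l hk hl
    have hs := heat_hasFiniteSupport (S := S) k
    calc ∑' x, heat S k x * (wordLength S x : ℝ) ^ m * heat S l x
        ≤ ∑' x, heat S k x * (wordLength S x : ℝ) ^ m * (D * heat S (t + s) 1) :=
          Summable.tsum_le_tsum (fun x => mul_le_mul_of_nonneg_left (hD l _ hl x)
            (mul_nonneg (heat_nonneg _ _) (by positivity)))
            (summable_of_eq_zero hs hs fun x h _ => by simp [h])
            (summable_of_eq_zero hs hs fun x h _ => by simp [h])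
      _ ≤ C * √t ^ m * (D * heat S (t + s) 1) := by
          rw [tsum_mul_right]
          refine mul_le_mul_of_nonneg_right ((hC k).trans ?_) (mul_nonneg hD0 hn)
          gcongr
      _ = _ := by ring
  obtain h | h := le_total t s
  · simp only [← mul_assoc]
    exact bound t s le_rfl (by omega)
  · refine le_trans (le_of_eq (tsum_congr fun x => ?_)) (bound s t h (by omega))
    ring

end AvgDehnPaper
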